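/- Let M = M(S; F(I), G(Lambda); P) be a Rees matrix semigroup without zero over a semigroupoid S (so the sandwich matrix P has no zero entries). Suppose S is automatic and M is finitely generated (as a semigroup). Then M is an automatic semigroup. -/

import Mathlib

/- Common framework: graphs, path languages, synchronous regularity,
   semigroupoids, automatic structures, and Rees matrix constructions. -/

namespace AutoRees

/-- Raw data of a semigroupoid: source and target maps on arrows together with a
totalised multiplication (whose values are only meaningful on composable pairs). -/
structure PreSgpd (O A : Type) where
  src : A → O
  tgt : A → O
  mul : A → A → A

/-- A semigroupoid: the multiplication respects sources and targets and is
associative, on composable pairs. -/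
structure Sgpd (O A : Type) extends PreSgpd O A where
  src_mul : ∀ e f, tgt e = src f → src (mul e f) = src e
  tgt_mul : ∀ e f, tgt e = src f → tgt (mul e f) = tgt f
  mul_assoc' : ∀ e f g, tgt e = src f → tgt f = src g →
    mul (mul e f) g = mul e (mul f g)

/-- Evaluate a nonempty word of edge labels as a product in the semigroupoid
(`none` on the empty word). -/
def evalPath? {O A E : Type} (S : PreSgpd O A) (lab : E → A) : List E → Option A
  | [] => none
  | e :: l => some ((l.map lab).foldl S.mul (lab e))

/-- The consecutive-compatibility condition making a list of edges a path. -/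
def IsPathChain {V E : Type} (esrc etgt : E → V) (l : List E) : Prop :=
  List.Chain' (fun e f => etgt e = esrc f) l

/-- The target of a non-empty path. -/
def pathTgt? {V E : Type} (etgt : E → V) (l : List E) : Option V :=
  l.getLast?.map etgt

/-- The source of a non-empty path. -/
def pathSrc? {V E : Type} (esrc : E → V) (l : List E) : Option V :=
  l.head?.map esrc

/-- A set of words is regular if it is a regular language in the usual sense. -/
def IsRegularSet {α : Type} (L : Set (List α)) : Prop :=
  Language.IsRegular (show Language α from L)

/-- The padding symbol used to pad a pair of paths, at the target of `l`
(the letters of the padded alphabet `X^$` are `Sum.inl` (a genuine edge) or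
`Sum.inr (some v)` (the padding edge at vertex `v`)). -/
def padSym {V E : Type} (etgt : E → V) (l : List E) : E ⊕ Option V :=
  Sum.inr (l.getLast?.map etgt)

/-- The padded convolution `(a, b) δ_X` of a pair of paths. -/
def deltaPair {V E : Type} (etgt : E → V) (a b : List E) :
    List ((E ⊕ Option V) × (E ⊕ Option V)) :=
  (a.map Sum.inl).zip (b.map Sum.inl) ++
    (if a.length ≤ b.length
      then (b.drop a.length).map (fun e => (padSym etgt a, Sum.inl e))
      else (a.drop b.length).map (fun e => (Sum.inl e, padSym etgt b)))

/-- A binary relation on paths is synchronously regular if its image under the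
padding map is a regular language over the padded product alphabet. -/
def SyncRegular {V E : Type} (etgt : E → V) (R : Set (List E × List E)) : Prop :=
  IsRegularSet { w | ∃ p ∈ R, w = deltaPair etgt p.1 p.2 }

/-- A choice of representatives `(X, K, ρ)` for a semigroupoid `S`: a graph `X`
with vertex set `S^0` (edge set `E`, source `esrc`, target `etgt`), a semigroupoid
morphism `ρ : X^+ → S` (induced by the edge-labelling `lab`), and a language `K`
of non-empty paths with `K ρ = S^1`. -/
structure ChoiceOfReps {O A : Type} (S : PreSgpd O A) (E : Type) where
  esrc : E → O
  etgt : E → O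
  lab : E → A
  lab_src : ∀ e, S.src (lab e) = esrc e
  lab_tgt : ∀ e, S.tgt (lab e) = etgt e
  K : Set (List E)
  K_path : ∀ l ∈ K, l ≠ [] ∧ IsPathChain esrc etgt l
  K_onto : ∀ a : A, ∃ l ∈ K, evalPath? S lab l = some a

variable {O A E : Type} {S : PreSgpd O A}

/-- The relation `K_=` = {(u,v) ∈ K × K : u ρ = v ρ}. -/
def relEq (C : ChoiceOfReps S E) : Set (List E × List E) :=
  { p | p.1 ∈ C.K ∧ p.2 ∈ C.K ∧ evalPath? S C.lab p.1 = evalPath? S C.lab p.2 }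

/-- The relation `K_a` for an edge `a` of `X`. -/
def relEdge (C : ChoiceOfReps S E) (a : E) : Set (List E × List E) :=
  { p | p.1 ∈ C.K ∧ p.2 ∈ C.K ∧ pathTgt? C.etgt p.1 = some (C.esrc a) ∧
        evalPath? S C.lab (p.1 ++ [a]) = evalPath? S C.lab p.2 }

/-- The relation `K_a` for a vertex `a` of `X` (regarded as the empty path at `a`). -/
def relVertex (C : ChoiceOfReps S E) (v : O) : Set (List E × List E) :=
  { p | p.1 ∈ C.K ∧ p.2 ∈ C.K ∧ pathTgt? C.etgt p.1 = some v ∧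
        evalPath? S C.lab p.1 = evalPath? S C.lab p.2 }

/-- An automatic structure: a finitely generated choice of representatives with
`K` regular such that `K_a` is synchronously regular for every edge and vertex. -/
def IsAutomaticStructure (C : ChoiceOfReps S E) : Prop :=
  Finite E ∧ IsRegularSet C.K ∧
    (∀ a : E, SyncRegular C.etgt (relEdge C a)) ∧
    (∀ v : O, SyncRegular C.etgt (relVertex C v))

/-- The set of non-empty prefixes of words in `K`. -/
def prefs {E : Type} (K : Set (List E)) : Set (List E) :=
  { p | p ≠ [] ∧ ∃ l ∈ K, p <+: l }

/-- The relation `K'_=` = {(u,v) ∈ K × Pref(K) : u ρ = v ρ}. -/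
def relPrefEq (C : ChoiceOfReps S E) : Set (List E × List E) :=
  { p | p.1 ∈ C.K ∧ p.2 ∈ prefs C.K ∧ evalPath? S C.lab p.1 = evalPath? S C.lab p.2 }

/-- A prefix-automatic structure. -/
def IsPrefixAutomaticStructure (C : ChoiceOfReps S E) : Prop :=
  IsAutomaticStructure C ∧ SyncRegular C.etgt (relPrefEq C)

/-- A cross-section: `ρ` restricted to `K` is injective. -/
def IsCrossSection (C : ChoiceOfReps S E) : Prop :=
  ∀ u ∈ C.K, ∀ v ∈ C.K, evalPath? S C.lab u = evalPath? S C.lab v → u = v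

/-- `K` is closed under taking non-empty prefixes. -/
def IsPrefixClosed (C : ChoiceOfReps S E) : Prop :=
  ∀ l ∈ C.K, ∀ p : List E, p ≠ [] → p <+: l → p ∈ C.K

/-- A semigroupoid (or semigroup, in the one-object case) is automatic if it
admits an automatic structure. -/
def IsAutomatic (S : PreSgpd O A) : Prop :=
  ∃ (E : Type) (C : ChoiceOfReps S E), IsAutomaticStructure C

/-- Prefix-automaticity. -/
def IsPrefixAutomatic (S : PreSgpd O A) : Prop :=
  ∃ (E : Type) (C : ChoiceOfReps S E), IsPrefixAutomaticStructure C

/-- Finite generation: every arrow is a (composable) product of arrows from some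
fixed finite set. -/
def IsFG (S : PreSgpd O A) : Prop :=
  ∃ T : Set A, T.Finite ∧ ∀ a : A, ∃ l : List A, l ≠ [] ∧ (∀ x ∈ l, x ∈ T) ∧
    IsPathChain S.src S.tgt l ∧ evalPath? S id l = some a

/-- An arrow is an identity if it acts as an identity on all composable products. -/
def IsIdentity (S : PreSgpd O A) (e : A) : Prop :=
  (∀ x, S.tgt e = S.src x → S.mul e x = x) ∧ (∀ y, S.tgt y = S.src e → S.mul y e = y)

/-- A small category is a semigroupoid with an identity arrow at every object. -/
def IsSmallCategory (S : PreSgpd O A) : Prop :=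
  ∀ v : O, ∃ e : A, S.src e = v ∧ S.tgt e = v ∧ IsIdentity S e

/-- No object is isolated. -/
def IsolationFree (S : PreSgpd O A) : Prop :=
  ∀ v : O, ∃ a : A, S.src a = v ∨ S.tgt a = v

namespace Rees

variable {O A I Λ : Type}

/-- A triple `(i, x, λ)` is valid if `i F = x α` and `x ω = λ G`. -/
def Valid (S : Sgpd O A) (F : I → O) (G : Λ → O) (t : I × A × Λ) : Prop :=
  F t.1 = S.src t.2.1 ∧ S.tgt t.2.1 = G t.2.2

/-- The set of valid Rees triples. -/
def Triples (S : Sgpd O A) (F : I → O) (G : Λ → O) : Type :=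
  { t : I × A × Λ // Valid S F G t }

theorem prod_valid (S : Sgpd O A) {F : I → O} {G : Λ → O}
    {i : I} {x : A} {lam : Λ} {j : I} {y : A} {mu : Λ} {p : A}
    (hx : Valid S F G (i, x, lam)) (hy : Valid S F G (j, y, mu))
    (hps : S.src p = G lam) (hpt : S.tgt p = F j) :
    Valid S F G (i, S.mul (S.mul x p) y, mu) := by
  obtain ⟨hx1, hx2⟩ := hx
  obtain ⟨hy1, hy2⟩ := hy
  have h1 : S.tgt x = S.src p := by rw [hps]; exact hx2
  have h2 : S.tgt p = S.src y := by rw [hpt]; exact hy1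
  have h3 : S.tgt (S.mul x p) = S.src y := by rw [S.tgt_mul x p h1]; exact h2
  constructor
  · show F i = S.src (S.mul (S.mul x p) y)
    rw [S.src_mul _ y h3, S.src_mul x p h1]; exact hx1
  · show S.tgt (S.mul (S.mul x p) y) = G mu
    rw [S.tgt_mul _ y h3]; exact hy2

/-- Data for a Rees matrix construction with zero over a semigroupoid `S`:
indexing functions `F`, `G` surjective onto the sets of sources and of targets
respectively, and a sandwich matrix `P` with entries in `S^1 ∪ {0}`
(`none` representing `0`) compatible with `F` and `G`. -/
structure Data0 (S : Sgpd O A) (I Λ : Type) where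
  F : I → O
  G : Λ → O
  P : Λ → I → Option A
  F_into : ∀ i, ∃ a : A, S.src a = F i
  F_onto : ∀ a : A, ∃ i, F i = S.src a
  G_into : ∀ lam, ∃ a : A, S.tgt a = G lam
  G_onto : ∀ a : A, ∃ lam, G lam = S.tgt a
  P_src : ∀ lam i p, P lam i = some p → S.src p = G lam
  P_tgt : ∀ lam i p, P lam i = some p → S.tgt p = F i

/-- Underlying set of the Rees matrix semigroup with zero (`none` is the zero). -/
def Carrier0 (S : Sgpd O A) (R : Data0 S I Λ) : Type :=
  Option (Triples S R.F R.G)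

/-- Multiplication of the Rees matrix semigroup with zero. -/
def mul0 (S : Sgpd O A) (R : Data0 S I Λ) :
    Carrier0 S R → Carrier0 S R → Carrier0 S R
  | some ⟨(i, x, lam), hx⟩, some ⟨(j, y, mu), hy⟩ =>
    match hp : R.P lam j with
    | some p => some ⟨(i, S.mul (S.mul x p) y, mu),
        prod_valid S hx hy (R.P_src lam j p hp) (R.P_tgt lam j p hp)⟩
    | none => none
  | none, _ => none
  | _, none => none

/-- The Rees matrix semigroup with zero `M^0(S; F(I), G(Λ); P)`, as a
one-object semigroupoid (i.e. a semigroup). -/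
def pre0 (S : Sgpd O A) (R : Data0 S I Λ) : PreSgpd Unit (Carrier0 S R) where
  src _ := ()
  tgt _ := ()
  mul := mul0 S R

/-- Data for a Rees matrix construction without zero (no zero entries in `P`). -/
structure Data (S : Sgpd O A) (I Λ : Type) where
  F : I → O
  G : Λ → O
  P : Λ → I → A
  F_into : ∀ i, ∃ a : A, S.src a = F i
  F_onto : ∀ a : A, ∃ i, F i = S.src a
  G_into : ∀ lam, ∃ a : A, S.tgt a = G lam
  G_onto : ∀ a : A, ∃ lam, G lam = S.tgt a
  P_src : ∀ lam i, S.src (P lam i) = G lam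
  P_tgt : ∀ lam i, S.tgt (P lam i) = F i

/-- Underlying set of the Rees matrix semigroup without zero. -/
def Carrier (S : Sgpd O A) (R : Data S I Λ) : Type :=
  Triples S R.F R.G

/-- Multiplication of the Rees matrix semigroup without zero. -/
def mul (S : Sgpd O A) (R : Data S I Λ) :
    Carrier S R → Carrier S R → Carrier S R
  | ⟨(i, x, lam), hx⟩, ⟨(j, y, mu), hy⟩ =>
    ⟨(i, S.mul (S.mul x (R.P lam j)) y, mu),
      prod_valid S hx hy (R.P_src lam j) (R.P_tgt lam j)⟩

/-- The Rees matrix semigroup without zero `M(S; F(I), G(Λ); P)`, as a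
one-object semigroupoid (i.e. a semigroup). -/
def pre (S : Sgpd O A) (R : Data S I Λ) : PreSgpd Unit (Carrier S R) where
  src _ := ()
  tgt _ := ()
  mul := mul S R

/-- The set `S P' S` of arrows of the form `s p t` with `p` a non-zero entry of `P`. -/
def SPS0 (S : Sgpd O A) (R : Data0 S I Λ) : Set A :=
  { a | ∃ s p t lam i, R.P lam i = some p ∧ S.tgt s = S.src p ∧ S.tgt p = S.src t ∧
        a = S.mul (S.mul s p) t }

/-- The set `S P S` for a matrix without zero entries. -/
def SPS (S : Sgpd O A) (R : Data S I Λ) : Set A :=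
  { a | ∃ s t lam i, S.tgt s = S.src (R.P lam i) ∧ S.tgt (R.P lam i) = S.src t ∧
        a = S.mul (S.mul s (R.P lam i)) t }

/-- The set of targets of arrows of `S` (the codomain of `G`). -/
def tgtSet (S : Sgpd O A) : Set O := { v | ∃ a : A, S.tgt a = v }

/-- `T` is strongly right-ideal-generated by a row cross-section of `P`. -/
def StronglyRIG0 (S : Sgpd O A) (R : Data0 S I Λ) (T : Set A) : Prop :=
  ∃ Λ' : Set Λ, Set.BijOn R.G Λ' (tgtSet S) ∧
    ∀ t ∈ T, ∃ lam ∈ Λ', ∃ i p s, R.P lam i = some p ∧ S.tgt p = S.src s ∧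
      t = S.mul p s

/-- `T` is weakly right-ideal-generated by a row cross-section of `P`. -/
def WeaklyRIG0 (S : Sgpd O A) (R : Data0 S I Λ) (T : Set A) : Prop :=
  ∃ Λ' : Set Λ, Set.BijOn R.G Λ' (tgtSet S) ∧
    ∀ t ∈ T, ∃ lam ∈ Λ', ∃ i p, R.P lam i = some p ∧
      (t = p ∨ ∃ s, S.tgt p = S.src s ∧ t = S.mul p s)

/-- Weak right-ideal generation, for a matrix without zero entries. -/
def WeaklyRIG (S : Sgpd O A) (R : Data S I Λ) (T : Set A) : Prop :=
  ∃ Λ' : Set Λ, Set.BijOn R.G Λ' (tgtSet S) ∧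
    ∀ t ∈ T, ∃ lam ∈ Λ', ∃ i,
      (t = R.P lam i ∨ ∃ s, S.tgt (R.P lam i) = S.src s ∧ t = S.mul (R.P lam i) s)

end Rees


/-! ### Regular languages, coalgebraically -/

theorem reg_coalg {α σ : Type} [Finite σ] (L : σ → Set (List α)) (step : σ → α → σ)
    (h : ∀ q a w, a :: w ∈ L q ↔ w ∈ L (step q a)) (q0 : σ) : IsRegularSet (L q0) := by
  classical
  have := Fintype.ofFinite σ
  refine ⟨σ, inferInstance, ⟨step, q0, {q | [] ∈ L q}⟩, ?_⟩
  have key : ∀ (w : List α) (q : σ), w.foldl step q ∈ {q | [] ∈ L q} ↔ w ∈ L q := by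
    intro w
    induction w with
    | nil => intro q; exact Iff.rfl
    | cons a w ih => intro q; rw [h, ← ih]; exact Iff.rfl
  ext w
  exact key w q0

theorem reg_elim {α : Type} {L : Set (List α)} (h : IsRegularSet L) :
    ∃ (σ : Type) (_ : Finite σ) (Lf : σ → Set (List α)) (step : σ → α → σ) (q0 : σ),
      (∀ q a w, a :: w ∈ Lf q ↔ w ∈ Lf (step q a)) ∧ L = Lf q0 := by
  obtain ⟨σ, hσ, D, hD⟩ := h
  refine ⟨σ, Finite.of_fintype σ, fun q => {w | D.evalFrom q w ∈ D.accept}, D.step, D.start,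
    ?_, ?_⟩
  · intro q a w; exact Iff.rfl
  · exact hD.symm

theorem coalg_append {α σ : Type} {Lf : σ → Set (List α)} {step : σ → α → σ}
    (h : ∀ q a w, a :: w ∈ Lf q ↔ w ∈ Lf (step q a)) (u w : List α) (q : σ) :
    u ++ w ∈ Lf q ↔ w ∈ Lf (u.foldl step q) := by
  induction u generalizing q with
  | nil => exact Iff.rfl
  | cons a u ih => rw [List.cons_append, h, ih]; exact Iff.rfl

theorem reg_inter {α : Type} {L L' : Set (List α)} (h : IsRegularSet L) (h' : IsRegularSet L') :
    IsRegularSet {w | w ∈ L ∧ w ∈ L'} := by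
  obtain ⟨σ, _, Lf, st, q, hc, rfl⟩ := reg_elim h
  obtain ⟨σ', _, Lf', st', q', hc', rfl⟩ := reg_elim h'
  exact reg_coalg (fun p : σ × σ' => {w | w ∈ Lf p.1 ∧ w ∈ Lf' p.2})
    (fun p a => (st p.1 a, st' p.2 a)) (fun p a w => and_congr (hc _ _ _) (hc' _ _ _)) (q, q')

theorem reg_compl {α : Type} {L : Set (List α)} (h : IsRegularSet L) :
    IsRegularSet {w | w ∉ L} := by
  obtain ⟨σ, _, Lf, st, q, hc, rfl⟩ := reg_elim h
  exact reg_coalg (fun p : σ => {w | w ∉ Lf p}) st (fun p a w => not_congr (hc _ _ _)) q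

theorem reg_iUnion {α ι : Type} [Finite ι] {L : ι → Set (List α)}
    (h : ∀ i, IsRegularSet (L i)) : IsRegularSet {w | ∃ i, w ∈ L i} := by
  choose σ hσ Lf st q hc hL using fun i => reg_elim (h i)
  have := reg_coalg (σ := ∀ i, σ i) (fun p => {w | ∃ i, w ∈ Lf i (p i)})
    (fun p a i => st i (p i) a) (fun p a w => exists_congr fun i => hc i _ _ _) q
  have e : {w | ∃ i, w ∈ L i} = {w | ∃ i, w ∈ Lf i (q i)} := by
    ext w; exact exists_congr fun i => by rw [hL i]
  rw [e]; exact this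

theorem reg_flatMap {α β : Type} {L : Set (List β)} (h : IsRegularSet L) (f : α → List β) :
    IsRegularSet {w : List α | w.flatMap f ∈ L} := by
  obtain ⟨σ, _, Lf, st, q, hc, rfl⟩ := reg_elim h
  exact reg_coalg (fun p : σ => {w : List α | w.flatMap f ∈ Lf p}) (fun p a => (f a).foldl st p)
    (fun p a w => by
      simp only [Set.mem_ofPred_eq, List.flatMap_cons]
      exact coalg_append hc _ _ _) q

theorem reg_comap {α β : Type} {L : Set (List β)} (h : IsRegularSet L) (f : α → β) :
    IsRegularSet {w : List α | w.map f ∈ L} := by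
  obtain ⟨σ, _, Lf, st, q, hc, rfl⟩ := reg_elim h
  exact reg_coalg (fun p : σ => {w : List α | w.map f ∈ Lf p}) (fun p a => st p (f a))
    (fun p a w => hc _ _ _) q

/-- Letter-to-letter sequential transducer. -/
def mealy {α β s : Type} (out : s → α → β) (next : s → α → s) : s → List α → List β
  | _, [] => []
  | x, a :: w => out x a :: mealy out next (next x a) w

theorem reg_mealy {α β s : Type} [Finite s] {L : Set (List α)} (h : IsRegularSet L)
    (out : s → α → β) (next : s → α → s) (x : s) :
    IsRegularSet {o : List β | ∃ w ∈ L, mealy out next x w = o} := by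
  obtain ⟨σ, _, Lf, st, q, hc, rfl⟩ := reg_elim h
  have := reg_coalg (σ := Set (σ × s))
    (fun X => {o : List β | ∃ p ∈ X, ∃ w ∈ Lf p.1, mealy out next p.2 w = o})
    (fun X b => {p' | ∃ p ∈ X, ∃ a, out p.2 a = b ∧ p' = (st p.1 a, next p.2 a)})
    (by
      intro X b o
      constructor
      · rintro ⟨p, hp, w, hw, he⟩
        cases w with
        | nil => simp [mealy] at he
        | cons a w =>
          simp only [mealy, List.cons.injEq] at he
          exact ⟨_, ⟨p, hp, a, he.1, rfl⟩, w, (hc _ _ _).1 hw, he.2⟩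
      · rintro ⟨_, ⟨p, hp, a, ha, rfl⟩, w, hw, he⟩
        refine ⟨p, hp, a :: w, (hc _ _ _).2 hw, ?_⟩
        simp only [mealy, List.cons.injEq]
        exact ⟨ha, he⟩) {(q, x)}
  simpa using this

theorem mealy_map {α β : Type} (f : α → β) (w : List α) :
    mealy (fun (_ : Unit) a => f a) (fun _ _ => ()) () w = w.map f := by
  induction w with
  | nil => rfl
  | cons a w ih => simp [mealy, ih]

theorem reg_map {α β : Type} {L : Set (List α)} (h : IsRegularSet L) (f : α → β) :
    IsRegularSet {o : List β | ∃ w ∈ L, w.map f = o} := by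
  have := reg_mealy h (fun (_ : Unit) a => f a) (fun _ _ => ()) ()
  simpa only [mealy_map] using this

theorem reg_quot {α : Type} {L : Set (List α)} (h : IsRegularSet L) (a : α) :
    IsRegularSet {w : List α | ∃ k, w ++ List.replicate k a ∈ L} := by
  obtain ⟨σ, _, Lf, st, q, hc, rfl⟩ := reg_elim h
  exact reg_coalg (fun p : σ => {w : List α | ∃ k, w ++ List.replicate k a ∈ Lf p}) st
    (fun p b w => exists_congr fun k => hc _ _ _) q

theorem reg_all {α : Type} (Y : Set α) : IsRegularSet {w : List α | ∀ a ∈ w, a ∈ Y} := by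
  have := reg_coalg (σ := Prop) (fun p => {w : List α | p ∧ ∀ a ∈ w, a ∈ Y})
    (fun p a => p ∧ a ∈ Y) (by intro p a w; simp [and_assoc]) True
  simpa using this

theorem reg_head {α : Type} (Y : Set α) : IsRegularSet {w : List α | ∃ a ∈ w.head?, a ∈ Y} := by
  have := reg_coalg (σ := Option Prop)
    (fun p => {w : List α | p.elim (∃ a ∈ w.head?, a ∈ Y) id})
    (fun p a => some (p.elim (a ∈ Y) id)) (by intro p a w; cases p <;> simp) none
  simpa using this

theorem reg_last {α : Type} (Y : Set α) :
    IsRegularSet {w : List α | ∃ a ∈ w.getLast?, a ∈ Y} := by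
  have := reg_coalg (σ := Prop)
    (fun p => {w : List α | w.getLast?.elim p (fun a => a ∈ Y)})
    (fun p a => a ∈ Y) (by
      intro p a w
      rcases List.eq_nil_or_concat w with rfl | ⟨w, b, rfl⟩
      · simp
      · simp [List.getLast?_cons]) False
  have e : {w : List α | ∃ a ∈ w.getLast?, a ∈ Y}
      = {w : List α | w.getLast?.elim False (fun a => a ∈ Y)} := by
    ext w
    show (∃ a ∈ w.getLast?, a ∈ Y) ↔ (w.getLast?.elim False (fun a => a ∈ Y) : Prop)
    cases w.getLast? <;> simp
  rw [e]; exact this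

/-! ### Padding -/

/-- Pad a word to length `n`. -/
def padTo {E : Type} : ℕ → List E → List (Option E)
  | 0, _ => []
  | n + 1, [] => none :: padTo n []
  | n + 1, a :: l => some a :: padTo n l

theorem padTo_length {E : Type} (n : ℕ) (l : List E) : (padTo n l).length = n := by
  induction n generalizing l with
  | zero => rfl
  | succ n ih => cases l <;> simp [padTo, ih]

theorem padTo_nil {E : Type} (n : ℕ) : padTo n ([] : List E) = List.replicate n none := by
  induction n with
  | zero => rfl
  | succ n ih => simp [padTo, ih, List.replicate_succ]

theorem padTo_append {E : Type} (u v : List E) (n : ℕ) :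
    padTo (u.length + n) (u ++ v) = u.map some ++ padTo n v := by
  induction u with
  | nil => simp
  | cons a u ih =>
    have : (a :: u).length + n = (u.length + n) + 1 := by simp; omega
    rw [this]; simp [padTo, ih]

theorem padTo_self {E : Type} (u : List E) : padTo u.length u = u.map some := by
  have := padTo_append u [] 0
  simpa [padTo] using this

theorem padTo_add {E : Type} (u : List E) (n k : ℕ) (h : u.length ≤ n) :
    padTo (n + k) u = padTo n u ++ List.replicate k none := by
  induction n generalizing u with
  | zero =>
    have : u = [] := by simpa using h
    subst this; simp [padTo_nil, padTo]
  | succ n ih =>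
    have e : n + 1 + k = (n + k) + 1 := by omega
    rw [e]
    cases u with
    | nil => simp [padTo, ih [] (by simp)]
    | cons a u => simp [padTo, ih u (by simpa using h)]

theorem padTo_flat {E : Type} (u : List E) (n : ℕ) (h : u.length ≤ n) :
    (padTo n u).flatMap Option.toList = u := by
  induction n generalizing u with
  | zero =>
    have : u = [] := by simpa using h
    subst this; simp [padTo]
  | succ n ih =>
    cases u with
    | nil => simp [padTo, ih [] (by simp)]
    | cons a u => simp [padTo, ih u (by simpa using h)]

theorem padTo_none_mem {E : Type} (u : List E) (n : ℕ) :
    none ∈ padTo n u ↔ u.length < n := by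
  induction n generalizing u with
  | zero => simp [padTo]
  | succ n ih => cases u <;> simp [padTo, ih]

/-- Validly padded words. -/
def validPad (E : Type) : Set (List (Option E)) :=
  {w | ∃ u : List E, u.length ≤ w.length ∧ w = padTo w.length u}

theorem reg_validPad (E : Type) : IsRegularSet (validPad E) := by
  have := reg_coalg (σ := Option Bool) (α := Option E)
    (fun p => match p with
      | none => ∅
      | some false => {w | w = padTo w.length []}
      | some true => validPad E)
    (fun p a => match p, a with
      | some true, some _ => some true
      | some true, none => some false
      | some false, none => some false
      | _, _ => none)
    (by
      intro p a w
      rcases p with _ | _ | _ <;> rcases a with _ | a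
      · simp
      · simp
      · simp [padTo]
      · simp [padTo]
      · simp only [validPad, Set.mem_ofPred_eq, List.length_cons]
        constructor
        · rintro ⟨u, h1, h2⟩
          cases u with
          | nil => simpa [padTo] using h2
          | cons b u => simp [padTo] at h2
        · intro h
          exact ⟨[], by simp, by simpa [padTo] using h⟩
      · simp only [validPad, Set.mem_ofPred_eq, List.length_cons]
        constructor
        · rintro ⟨u, h1, h2⟩
          cases u with
          | nil => simp [padTo] at h2
          | cons b u => 
            simp [padTo] at h2
            exact ⟨u, by simpa using h1, h2.2⟩
        · rintro ⟨u, h1, h2⟩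
          exact ⟨a :: u, by simpa using h1, by simpa [padTo] using h2⟩) (some true)
  exact this

/-- Padded convolution. -/
def pconv {E F : Type} (n : ℕ) (u : List E) (v : List F) : List (Option E × Option F) :=
  (padTo n u).zip (padTo n v)

theorem pconv_fst {E F : Type} (n : ℕ) (u : List E) (v : List F) :
    (pconv n u v).map Prod.fst = padTo n u := by
  rw [pconv, List.map_fst_zip]; simp [padTo_length]

theorem pconv_snd {E F : Type} (n : ℕ) (u : List E) (v : List F) :
    (pconv n u v).map Prod.snd = padTo n v := by
  rw [pconv, List.map_snd_zip]; simp [padTo_length]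

theorem eq_pconv {E F : Type} {n : ℕ} {u : List E} {v : List F} {W : List (Option E × Option F)}
    (h1 : W.map Prod.fst = padTo n u) (h2 : W.map Prod.snd = padTo n v) : W = pconv n u v := by
  rw [pconv, ← h1, ← h2]
  induction W generalizing n u v with
  | nil => rfl
  | cons a W ih =>
    cases n with
    | zero => simp [padTo] at h1
    | succ n =>
      simp only [List.map_cons, List.zip_cons_cons]
      congr 1
      cases u <;> cases v <;> simp only [padTo, List.map_cons, List.cons.injEq] at h1 h2 <;>
        exact ih h1.2 h2.2

theorem pconv_add {E F : Type} (u : List E) (v : List F) (n k : ℕ) (h : u.length ≤ n)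
    (h' : v.length ≤ n) :
    pconv (n + k) u v = pconv n u v ++ List.replicate k (none, none) := by
  rw [pconv, padTo_add _ _ _ h, padTo_add _ _ _ h', List.zip_append (by simp [padTo_length])]
  simp [pconv, List.zip_replicate']

theorem pconv_inj {E F : Type} {n n' : ℕ} {u u' : List E} {v v' : List F} (h1 : u.length ≤ n)
    (h2 : v.length ≤ n) (h1' : u'.length ≤ n') (h2' : v'.length ≤ n')
    (h : pconv n u v = pconv n' u' v') : u = u' ∧ v = v' := by
  constructor
  · have := congrArg (fun w => (w.map Prod.fst).flatMap Option.toList) h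
    simpa only [pconv_fst, padTo_flat _ _ h1, padTo_flat _ _ h1'] using this
  · have := congrArg (fun w => (w.map Prod.snd).flatMap Option.toList) h
    simpa only [pconv_snd, padTo_flat _ _ h2, padTo_flat _ _ h2'] using this

theorem pconv_max_no_none {E F : Type} (u : List E) (v : List F) :
    ∀ a ∈ pconv (max u.length v.length) u v, a ≠ (none, none) := by
  induction u generalizing v with
  | nil =>
    induction v with
    | nil => simp [pconv, padTo]
    | cons b v ih =>
      have e : max ([] : List E).length (b :: v).length
        = max ([] : List E).length v.length + 1 := by simp
      rw [e]
      intro a ha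
      simp only [pconv, padTo, List.zip_cons_cons, List.mem_cons] at ha
      rcases ha with rfl | ha
      · simp
      · exact ih a ha
  | cons c u ih =>
    cases v with
    | nil =>
      have e : max (c :: u).length ([] : List F).length
        = max u.length ([] : List F).length + 1 := by simp
      rw [e]
      intro a ha
      simp only [pconv, padTo, List.zip_cons_cons, List.mem_cons] at ha
      rcases ha with rfl | ha
      · simp
      · exact ih [] a ha
    | cons b v =>
      have e : max (c :: u).length (b :: v).length
        = max u.length v.length + 1 := by simp
      rw [e]
      intro a ha
      simp only [pconv, padTo, List.zip_cons_cons, List.mem_cons] at ha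
      rcases ha with rfl | ha
      · simp
      · exact ih v a ha

/-- Synchronous regularity, in a padding-insensitive form. -/
def SR {E F : Type} (R : Set (List E × List F)) : Prop :=
  ∃ L : Set (List (Option E × Option F)), IsRegularSet L ∧
    ∀ u v n, u.length ≤ n → v.length ≤ n → ((u, v) ∈ R ↔ pconv n u v ∈ L)

theorem filter_pconv {E F : Type} (u : List E) (v : List F) (n : ℕ) (h : u.length ≤ n)
    (h' : v.length ≤ n) :
    (pconv n u v).flatMap (fun a => a.1.elim (a.2.elim [] (fun _ => [a])) (fun _ => [a]))
      = pconv (max u.length v.length) u v := by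
  obtain ⟨k, rfl⟩ := Nat.exists_eq_add_of_le (max_le h h')
  rw [pconv_add _ _ _ _ (le_max_left _ _) (le_max_right _ _), List.flatMap_append]
  have h2 : (List.replicate k ((none, none) : Option E × Option F)).flatMap
      (fun a => a.1.elim (a.2.elim [] (fun _ => [a])) (fun _ => [a])) = [] := by
    simp
  rw [h2, List.append_nil]
  have := pconv_max_no_none u v
  generalize pconv (max u.length v.length) u v = W at this
  induction W with
  | nil => rfl
  | cons a W ih =>
    rw [List.flatMap_cons, ih (fun b hb => this b (List.mem_cons_of_mem _ hb))]
    have h3 := this a List.mem_cons_self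
    rcases a with ⟨_ | a, _ | b⟩ <;> simp at h3 ⊢

theorem SR_of_conv {E F : Type} {R : Set (List E × List F)}
    (h : IsRegularSet {w | ∃ p ∈ R, w = pconv (max p.1.length p.2.length) p.1 p.2}) : SR R := by
  refine ⟨_, reg_flatMap h (fun a => a.1.elim (a.2.elim [] (fun _ => [a])) (fun _ => [a])), ?_⟩
  intro u v n hu hv
  simp only [Set.mem_ofPred_eq]
  rw [filter_pconv u v n hu hv]
  constructor
  · intro h; exact ⟨_, h, rfl⟩
  · rintro ⟨⟨u', v'⟩, hp, he⟩
    obtain ⟨rfl, rfl⟩ := pconv_inj (le_max_left _ _) (le_max_right _ _) (le_max_left _ _)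
      (le_max_right _ _) he
    exact hp

theorem conv_of_SR {E F : Type} {R : Set (List E × List F)} (h : SR R) :
    IsRegularSet {w | ∃ p ∈ R, w = pconv (max p.1.length p.2.length) p.1 p.2} := by
  obtain ⟨L, hL, hR⟩ := h
  have := reg_inter (reg_inter hL (reg_all {a : Option E × Option F | a ≠ (none, none)}))
    (reg_inter (reg_comap (reg_validPad E) Prod.fst) (reg_comap (reg_validPad F) Prod.snd))
  convert this using 2
  ext w
  simp only [Set.mem_ofPred_eq]
  constructor
  · rintro ⟨⟨u, v⟩, hp, rfl⟩
    refine ⟨⟨(hR u v _ (le_max_left _ _) (le_max_right _ _)).1 hp, pconv_max_no_none u v⟩, ?_⟩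
    rw [pconv_fst, pconv_snd]
    exact ⟨⟨u, by simp [padTo_length], by simp [padTo_length]⟩,
      ⟨v, by simp [padTo_length], by simp [padTo_length]⟩⟩
  · rintro ⟨⟨hw, hn⟩, ⟨u, hu, hu'⟩, ⟨v, hv, hv'⟩⟩
    simp only [List.length_map] at hu hu' hv hv'
    have e := eq_pconv hu' hv'
    refine ⟨(u, v), (hR u v _ hu hv).2 (e ▸ hw), ?_⟩
    obtain ⟨k, hk⟩ := Nat.exists_eq_add_of_le (max_le hu hv)
    rw [hk, pconv_add _ _ _ _ (le_max_left _ _) (le_max_right _ _)] at e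
    cases k with
    | zero => simpa using e
    | succ k =>
      exfalso
      refine hn (none, none) ?_ rfl
      rw [e]; simp

theorem SR_restrict {E F : Type} {R : Set (List E × List F)} (h : SR R) {U : Set (List E)}
    {V : Set (List F)} (hU : IsRegularSet U) (hV : IsRegularSet V) :
    SR {p | p ∈ R ∧ p.1 ∈ U ∧ p.2 ∈ V} := by
  obtain ⟨L, hL, hR⟩ := h
  refine ⟨_, reg_inter hL (reg_inter
    (reg_comap (reg_flatMap hU Option.toList) Prod.fst)
    (reg_comap (reg_flatMap hV Option.toList) Prod.snd)), ?_⟩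
  intro u v n hu hv
  simp only [Set.mem_ofPred_eq]
  rw [hR u v n hu hv, pconv_fst, pconv_snd, padTo_flat _ _ hu, padTo_flat _ _ hv]

theorem SR_comp {E F G : Type} {R : Set (List E × List F)} {R' : Set (List F × List G)}
    (h : SR R) (h' : SR R') :
    SR {p : List E × List G | ∃ v, (p.1, v) ∈ R ∧ (v, p.2) ∈ R'} := by
  obtain ⟨L, hL, hR⟩ := h
  obtain ⟨L', hL', hR'⟩ := h'
  refine ⟨_, reg_quot (reg_map (reg_inter
    (reg_inter (reg_comap hL (fun a : Option E × Option F × Option G => (a.1, a.2.1)))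
      (reg_comap hL' (fun a : Option E × Option F × Option G => (a.2.1, a.2.2))))
    (reg_comap (reg_validPad F) (fun a : Option E × Option F × Option G => a.2.1)))
      (fun a => (a.1, a.2.2))) (none, none), ?_⟩
  intro u w n hu hw
  simp only [Set.mem_ofPred_eq]
  constructor
  · rintro ⟨v, h1, h2⟩
    refine ⟨v.length, (padTo (n + v.length) u).zip
      ((padTo (n + v.length) v).zip (padTo (n + v.length) w)), ⟨⟨?_, ?_⟩, ?_⟩, ?_⟩
    · convert (hR u v (n + v.length) (by omega) (by omega)).1 h1
      apply eq_pconv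
      · rw [List.map_map, show (Prod.fst ∘ fun a : Option E × Option F × Option G => (a.1, a.2.1))
          = Prod.fst from rfl, List.map_fst_zip]; simp [padTo_length]
      · rw [List.map_map, show (Prod.snd ∘ fun a : Option E × Option F × Option G => (a.1, a.2.1))
          = Prod.fst ∘ Prod.snd from rfl, ← List.map_map, List.map_snd_zip, List.map_fst_zip] <;>
          simp [padTo_length]
    · convert (hR' v w (n + v.length) (by omega) (by omega)).1 h2
      rw [show (fun a : Option E × Option F × Option G => (a.2.1, a.2.2)) = Prod.snd from rfl,
        List.map_snd_zip]
      · rfl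
      · simp [padTo_length]
    · rw [show (fun a : Option E × Option F × Option G => a.2.1) = Prod.fst ∘ Prod.snd from rfl,
        ← List.map_map, List.map_snd_zip, List.map_fst_zip]
      · exact ⟨v, by simp [padTo_length], by simp [padTo_length]⟩
      all_goals simp [padTo_length]
    · rw [← pconv_add _ _ _ _ hu hw]
      apply eq_pconv
      · rw [List.map_map, show (Prod.fst ∘ fun a : Option E × Option F × Option G => (a.1, a.2.2))
          = Prod.fst from rfl, List.map_fst_zip]; simp [padTo_length]
      · rw [List.map_map, show (Prod.snd ∘ fun a : Option E × Option F × Option G => (a.1, a.2.2))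
          = Prod.snd ∘ Prod.snd from rfl, ← List.map_map, List.map_snd_zip, List.map_snd_zip] <;>
          simp [padTo_length]
  · rintro ⟨k, W, ⟨⟨h1, h2⟩, v, hv, hv'⟩, he⟩
    rw [← pconv_add _ _ _ _ hu hw] at he
    have hlen : W.length = n + k := by
      have := congrArg List.length he
      simpa [pconv, padTo_length] using this
    rw [List.length_map, hlen] at hv hv'
    have e1 := congrArg (List.map Prod.fst) he
    have e2 := congrArg (List.map Prod.snd) he
    rw [pconv_fst, List.map_map] at e1
    rw [pconv_snd, List.map_map] at e2
    refine ⟨v, (hR u v (n + k) (by omega) hv).2 ?_, (hR' v w (n + k) hv (by omega)).2 ?_⟩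
    · convert h1
      refine (eq_pconv ?_ ?_).symm
      · rw [List.map_map]; exact e1
      · rw [List.map_map]; exact hv'
    · convert h2
      refine (eq_pconv ?_ ?_).symm
      · rw [List.map_map]; exact hv'
      · rw [List.map_map]; exact e2

theorem reg_longer {E F : Type} {R : Set (List E × List F)} (h : SR R) :
    IsRegularSet {u | ∃ v, (u, v) ∈ R ∧ v.length < u.length} := by
  obtain ⟨L, hL, hR⟩ := h
  have := reg_comap (reg_map (reg_inter hL (reg_inter (reg_comap (reg_validPad F) Prod.snd)
    (reg_compl (reg_all {a : Option E × Option F | a.2 ≠ none})))) Prod.fst) (some : E → Option E)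
  convert this using 2
  ext u
  simp only [Set.mem_ofPred_eq]
  constructor
  · rintro ⟨v, h1, h2⟩
    refine ⟨pconv u.length u v, ⟨(hR _ _ _ le_rfl h2.le).1 h1, ?_, ?_⟩, ?_⟩
    · rw [pconv_snd]; exact ⟨v, by simp [padTo_length, h2.le], by simp [padTo_length]⟩
    · intro hall
      have h3 := (padTo_none_mem v u.length).2 h2
      rw [← pconv_snd u.length u v, List.mem_map] at h3
      obtain ⟨a, ha, ha'⟩ := h3
      exact hall a ha ha'
    · rw [pconv_fst, padTo_self]
  · rintro ⟨W, ⟨h1, ⟨v, hv, hv'⟩, h3⟩, he⟩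
    have hlen : W.length = u.length := by simpa using congrArg List.length he
    rw [List.length_map, hlen] at hv hv'
    rw [← padTo_self] at he
    refine ⟨v, (hR u v _ le_rfl hv).2 (eq_pconv he hv' ▸ h1), ?_⟩
    rw [← padTo_none_mem, ← hv']
    have h4 : ∃ a ∈ W, a.2 = none := by
      by_contra hcon
      push Not at hcon
      exact h3 hcon
    obtain ⟨a, ha, ha'⟩ := h4
    exact List.mem_map.2 ⟨a, ha, ha'⟩

/-! ### The padding map `δ` -/

theorem delta_aux {E T : Type} (p q : T) (f : E → T) (a b : List E) :
    (a.map f).zip (b.map f) ++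
      (if a.length ≤ b.length then (b.drop a.length).map (fun e => (p, f e))
        else (a.drop b.length).map (fun e => (f e, q)))
    = (pconv (max a.length b.length) a b).map (fun o => (o.1.elim p f, o.2.elim q f)) := by
  induction a generalizing b with
  | nil =>
    simp only [List.map_nil, List.zip_nil_left, List.length_nil, Nat.zero_le, if_true,
      List.drop_zero, List.nil_append, Nat.zero_max]
    induction b with
    | nil => rfl
    | cons c b ih => simp [pconv, padTo] at ih ⊢; exact ih
  | cons c a ih =>
    cases b with
    | nil =>
      clear ih
      simp only [List.map_nil, List.zip_nil_right, List.length_nil, List.nil_append,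
        Nat.max_zero, List.drop_zero]
      rw [if_neg (by simp)]
      induction a generalizing c with
      | nil => simp [pconv, padTo]
      | cons d a ih => 
        have := ih d
        simp [pconv, padTo] at this ⊢; exact this
    | cons d b =>
      have := ih b
      simp only [List.length_cons, Nat.add_max_add_right, pconv, padTo] at this ⊢
      simp only [List.map_cons, List.zip_cons_cons, List.cons_append, List.drop_succ_cons,
        Nat.add_le_add_iff_right, this, Option.elim]

theorem delta_eq {V E : Type} (etgt : E → V) (a b : List E) :
    deltaPair etgt a b = (pconv (max a.length b.length) a b).map
      (fun o => (o.1.elim (padSym etgt a) Sum.inl, o.2.elim (padSym etgt b) Sum.inl)) :=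
  delta_aux _ _ _ _ _

theorem SR_of_sync {V E : Type} {etgt : E → V} {R : Set (List E × List E)}
    (h : SyncRegular etgt R) : SR R := by
  apply SR_of_conv
  have := reg_map h (fun o : (E ⊕ Option V) × (E ⊕ Option V) => (o.1.getLeft?, o.2.getLeft?))
  convert this using 2
  have key : ∀ a b, (deltaPair etgt a b).map (fun o => (o.1.getLeft?, o.2.getLeft?))
      = pconv (max a.length b.length) a b := by
    intro a b
    rw [delta_eq, List.map_map]
    conv_rhs => rw [← List.map_id (pconv _ a b)]
    apply List.map_congr_left
    rintro ⟨_ | x, _ | y⟩ - <;> simp [padSym]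
  ext w
  simp only [Set.mem_ofPred_eq]
  constructor
  · rintro ⟨p, hp, rfl⟩
    exact ⟨_, ⟨p, hp, rfl⟩, key _ _⟩
  · rintro ⟨_, ⟨p, hp, rfl⟩, rfl⟩
    exact ⟨p, hp, key _ _⟩

/-! ### Chunks -/

/-- Words of length at most `m`. -/
abbrev Chunk (E : Type) (m : ℕ) : Type := {l : List E // l.length ≤ m}

/-- Chunk sequences: all chunks but the last have length `m`, the last one is shorter. -/
def Chk {E : Type} {m : ℕ} : List (Chunk E m) → Prop
  | [] => False
  | c :: x => (c.1.length = m ∧ Chk x) ∨ (c.1.length < m ∧ x = [])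

/-- The word underlying a chunk sequence. -/
def flat {E : Type} {m : ℕ} (x : List (Chunk E m)) : List E := x.flatMap Subtype.val

theorem reg_Chk (E : Type) (m : ℕ) : IsRegularSet {x : List (Chunk E m) | Chk x} := by
  have := reg_coalg (σ := Option Bool) (α := Chunk E m)
    (fun p => match p with
      | none => ∅
      | some false => {w | w = []}
      | some true => {x | Chk x})
    (fun p c => match p with
      | some true => if c.1.length = m then some true else some false
      | _ => none)
    (by
      intro p c w
      rcases p with _ | _ | _
      · simp
      · simp
      · by_cases hc : c.1.length = m
        · simp [Chk, hc]
        · have : c.1.length < m := lt_of_le_of_ne c.2 hc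
          simp [Chk, hc, this]) (some true)
  exact this

theorem Chk.ne_nil {E : Type} {m : ℕ} {x : List (Chunk E m)} (h : Chk x) : x ≠ [] := by
  rintro rfl; exact h

theorem exists_Chk {E : Type} {m : ℕ} (hm : 0 < m) (u : List E) :
    ∃ x : List (Chunk E m), Chk x ∧ flat x = u := by
  induction hn : u.length using Nat.strong_induction_on generalizing u with
  | _ n ih =>
    by_cases h : u.length < m
    · exact ⟨[⟨u, h.le⟩], Or.inr ⟨h, rfl⟩, by simp [flat]⟩
    · obtain ⟨x, hx, hx'⟩ := ih (u.drop m).length (by simp; omega) (u.drop m) rfl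
      refine ⟨⟨u.take m, by simp⟩ :: x, Or.inl ⟨by simp; omega, hx⟩, ?_⟩
      simp only [flat, List.flatMap_cons] at hx' ⊢
      rw [hx', List.take_append_drop]

theorem flat_length {E : Type} {m : ℕ} (x : List (Chunk E m)) (N : ℕ) (h : x.length ≤ N) :
    (flat x).length ≤ N * m := by
  induction x generalizing N with
  | nil => simp [flat]
  | cons c x ih =>
    cases N with
    | zero => simp at h
    | succ N =>
      have := ih N (by simpa using h)
      have h2 := c.2
      simp only [flat, List.flatMap_cons, List.length_append] at this ⊢
      rw [Nat.succ_mul]; omega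

theorem replicate_chunk {E : Type} (m N : ℕ) :
    (padTo N ([] : List (Chunk E m))).flatMap (fun o => padTo m (o.elim [] Subtype.val))
      = List.replicate (N * m) none := by
  induction N with
  | zero => simp [padTo]
  | succ N ih =>
    rw [padTo, List.flatMap_cons, ih, Nat.succ_mul, Nat.add_comm, List.replicate_add]
    simp [padTo_nil]

theorem padTo_chunk {E : Type} {m : ℕ} (x : List (Chunk E m)) (hx : Chk x) (N : ℕ)
    (h : x.length ≤ N) :
    (padTo N x).flatMap (fun o => padTo m (o.elim [] Subtype.val)) = padTo (N * m) (flat x) := by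
  induction x generalizing N with
  | nil => exact hx.elim
  | cons c x ih =>
    cases N with
    | zero => simp at h
    | succ N =>
      rw [Nat.succ_mul, Nat.add_comm (N * m) m, padTo, List.flatMap_cons, flat, List.flatMap_cons]
      rcases hx with ⟨hc, hx⟩ | ⟨hc, rfl⟩
      · rw [ih hx N (by simpa using h)]
        have e1 : padTo m c.1 = c.1.map some := by rw [← padTo_self, hc]
        have e2 := padTo_append c.1 (flat x) (N * m)
        rw [hc] at e2
        simp only [Option.elim]
        rw [e1, ← e2]; rfl
      · rw [replicate_chunk]
        simp only [Option.elim, List.flatMap_nil, List.append_nil]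
        rw [padTo_add _ _ _ c.2]

theorem SR_chunk {E : Type} {m : ℕ} {R : Set (List E × List E)} (h : SR R) :
    SR {p : List (Chunk E m) × List (Chunk E m) |
      Chk p.1 ∧ Chk p.2 ∧ (flat p.1, flat p.2) ∈ R} := by
  obtain ⟨L, hL, hR⟩ := h
  refine ⟨_, reg_inter (reg_flatMap hL (fun o : Option (Chunk E m) × Option (Chunk E m) =>
      pconv m (o.1.elim [] Subtype.val) (o.2.elim [] Subtype.val)))
    (reg_inter (reg_comap (reg_flatMap (reg_Chk E m) Option.toList) Prod.fst)
      (reg_comap (reg_flatMap (reg_Chk E m) Option.toList) Prod.snd)), ?_⟩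
  intro x y N hx hy
  simp only [Set.mem_ofPred_eq]
  rw [pconv_fst, pconv_snd, padTo_flat _ _ hx, padTo_flat _ _ hy]
  have key : Chk x → Chk y → (pconv N x y).flatMap
      (fun o => pconv m (o.1.elim [] Subtype.val) (o.2.elim [] Subtype.val))
      = pconv (N * m) (flat x) (flat y) := by
    intro cx cy
    apply eq_pconv
    · rw [← padTo_chunk x cx N hx, ← pconv_fst N x y, List.map_flatMap, List.flatMap_map]
      simp only [pconv_fst]
    · rw [← padTo_chunk y cy N hy, ← pconv_snd N x y, List.map_flatMap, List.flatMap_map]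
      simp only [pconv_snd]
  constructor
  · rintro ⟨cx, cy, h⟩
    refine ⟨?_, cx, cy⟩
    rw [key cx cy]
    exact (hR _ _ _ (flat_length x N hx) (flat_length y N hy)).1 h
  · rintro ⟨h, cx, cy⟩
    rw [key cx cy] at h
    exact ⟨cx, cy, (hR _ _ _ (flat_length x N hx) (flat_length y N hy)).2 h⟩

/-- Encode a word, each letter together with its predecessor. -/
def psi {C B : Type} (f : Option C → C → B) : Option C → List C → List B :=
  mealy f (fun _ c => some c)

theorem psi_length {C B : Type} (f : Option C → C → B) (s : Option C) (x : List C) :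
    (psi f s x).length = x.length := by
  induction x generalizing s with
  | nil => rfl
  | cons c x ih =>
    have := ih (some c)
    simp only [psi, mealy, List.length_cons] at this ⊢
    rw [this]

theorem mealy_pair {C B : Type} (f g : Option C → C → B) (n : ℕ) (x y : List C)
    (s : Option C × Option C) :
    mealy (fun (s : Option C × Option C) (o : Option C × Option C) =>
        ((o.1.elim (Sum.inr (some ())) (fun c => Sum.inl (f s.1 c)) : B ⊕ Option Unit),
          (o.2.elim (Sum.inr (some ())) (fun c => Sum.inl (g s.2 c)) : B ⊕ Option Unit)))
        (fun _ o => o) s (pconv n x y)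
      = (pconv n (psi f s.1 x) (psi g s.2 y)).map
        (fun o => (o.1.elim (Sum.inr (some ())) Sum.inl, o.2.elim (Sum.inr (some ())) Sum.inl)) := by
  induction n generalizing x y s with
  | zero => rfl
  | succ n ih =>
    cases x <;> cases y
    · have := ih [] [] (none, none)
      simp only [pconv, psi, padTo, mealy, List.zip_cons_cons, List.map_cons] at this ⊢
      rw [this]; rfl
    · rename_i b y
      have := ih [] y (none, some b)
      simp only [pconv, psi, padTo, mealy, List.zip_cons_cons, List.map_cons] at this ⊢
      rw [this]; rfl
    · rename_i a x
      have := ih x [] (some a, none)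
      simp only [pconv, psi, padTo, mealy, List.zip_cons_cons, List.map_cons] at this ⊢
      rw [this]; rfl
    · rename_i a x b y
      have := ih x y (some a, some b)
      simp only [pconv, psi, padTo, mealy, List.zip_cons_cons, List.map_cons] at this ⊢
      rw [this]; rfl

theorem sync_psi {C B : Type} [Finite C] {R : Set (List C × List C)} (h : SR R)
    (hne : ∀ p ∈ R, p.1 ≠ [] ∧ p.2 ≠ []) (f g : Option C → C → B) (etgt : B → Unit) :
    IsRegularSet {w | ∃ p ∈ R, w = deltaPair etgt (psi f none p.1) (psi g none p.2)} := by
  have := reg_mealy (conv_of_SR h) (fun (s : Option C × Option C) (o : Option C × Option C) =>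
        ((o.1.elim (Sum.inr (some ())) (fun c => Sum.inl (f s.1 c)) : B ⊕ Option Unit),
          (o.2.elim (Sum.inr (some ())) (fun c => Sum.inl (g s.2 c)) : B ⊕ Option Unit)))
        (fun _ o => o) (none, none)
  have hpad : ∀ l : List B, l ≠ [] → padSym etgt l = Sum.inr (some ()) := by
    intro l hl
    rw [padSym, List.getLast?_eq_some_getLast hl]; rfl
  have key : ∀ p ∈ R, deltaPair etgt (psi f none p.1) (psi g none p.2)
      = mealy (fun (s : Option C × Option C) (o : Option C × Option C) =>
        ((o.1.elim (Sum.inr (some ())) (fun c => Sum.inl (f s.1 c)) : B ⊕ Option Unit),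
          (o.2.elim (Sum.inr (some ())) (fun c => Sum.inl (g s.2 c)) : B ⊕ Option Unit)))
        (fun _ o => o) (none, none) (pconv (max p.1.length p.2.length) p.1 p.2) := by
    intro p hp
    rw [mealy_pair, delta_eq, psi_length, psi_length, hpad, hpad]
    · rw [← List.length_pos_iff, psi_length, List.length_pos_iff]; exact (hne p hp).2
    · rw [← List.length_pos_iff, psi_length, List.length_pos_iff]; exact (hne p hp).1
  convert this using 2
  ext w
  constructor
  · rintro ⟨p, hp, rfl⟩
    exact ⟨_, ⟨p, hp, rfl⟩, (key p hp).symm⟩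
  · rintro ⟨_, ⟨p, hp, rfl⟩, rfl⟩
    exact ⟨p, hp, (key p hp).symm⟩

/-! ### Evaluation of paths -/

theorem fold_props {O A E : Type} (S : Sgpd O A) (C : ChoiceOfReps S.toPreSgpd E)
    (l : List E) (e : E) (g : A) (hl : IsPathChain C.esrc C.etgt (e :: l))
    (hg : S.tgt g = C.etgt e) :
    S.src ((l.map C.lab).foldl S.mul g) = S.src g ∧
    pathTgt? C.etgt (e :: l) = some (S.tgt ((l.map C.lab).foldl S.mul g)) ∧
    ∀ h, S.tgt h = S.src g →
      (l.map C.lab).foldl S.mul (S.mul h g) = S.mul h ((l.map C.lab).foldl S.mul g) := by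
  induction l generalizing e g with
  | nil => simp [pathTgt?, hg]
  | cons f l ih =>
    have h1 : C.etgt e = C.esrc f ∧ IsPathChain C.esrc C.etgt (f :: l) := by
      simpa [IsPathChain, List.Chain'] using hl
    have h2 : S.tgt g = S.src (C.lab f) := by rw [hg, h1.1, C.lab_src]
    obtain ⟨a1, a2, a3⟩ := ih f (S.mul g (C.lab f)) h1.2 (by rw [S.tgt_mul _ _ h2, C.lab_tgt])
    rw [S.src_mul _ _ h2] at a1 a3
    refine ⟨a1, ?_, ?_⟩
    · rw [← show pathTgt? C.etgt (f :: l) = pathTgt? C.etgt (e :: f :: l) by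
        simp [pathTgt?, List.getLast?_cons]]
      exact a2
    · intro h hh
      simp only [List.map_cons, List.foldl_cons]
      rw [S.mul_assoc' _ _ _ hh h2]
      exact a3 h hh

theorem eval_ends {O A E : Type} (S : Sgpd O A) (C : ChoiceOfReps S.toPreSgpd E)
    {l : List E} (hl : IsPathChain C.esrc C.etgt l) {a : A}
    (ha : evalPath? S.toPreSgpd C.lab l = some a) :
    pathSrc? C.esrc l = some (S.src a) ∧ pathTgt? C.etgt l = some (S.tgt a) := by
  cases l with
  | nil => simp [evalPath?] at ha
  | cons e l =>
    simp only [evalPath?, Option.some.injEq] at ha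
    subst ha
    obtain ⟨h1, h2, -⟩ := fold_props S C l e (C.lab e) hl (C.lab_tgt e)
    refine ⟨?_, h2⟩
    rw [h1, C.lab_src]; rfl

theorem eval_isSome {O A E : Type} (S : PreSgpd O A) (lab : E → A) {l : List E} (h : l ≠ []) :
    ∃ a, evalPath? S lab l = some a := by
  cases l with
  | nil => exact absurd rfl h
  | cons e l => exact ⟨_, rfl⟩

theorem eval_ne_nil {O A E : Type} {S : PreSgpd O A} {lab : E → A} {l : List E} {a : A}
    (h : evalPath? S lab l = some a) : l ≠ [] := by
  rintro rfl; simp [evalPath?] at h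

theorem eval_append_fold {O A E : Type} (S : PreSgpd O A) (lab : E → A) {u v : List E} {a : A}
    (h : evalPath? S lab u = some a) :
    evalPath? S lab (u ++ v) = some ((v.map lab).foldl S.mul a) := by
  cases u with
  | nil => simp [evalPath?] at h
  | cons e u =>
    simp only [evalPath?, Option.some.injEq] at h
    subst h
    simp [evalPath?]

theorem chain_left {V E : Type} {s t : E → V} {u v : List E} (h : IsPathChain s t (u ++ v)) :
    IsPathChain s t u := (List.isChain_append.1 h).1

theorem chain_right {V E : Type} {s t : E → V} {u v : List E} (h : IsPathChain s t (u ++ v)) :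
    IsPathChain s t v := (List.isChain_append.1 h).2.1

theorem eval_append {O A E : Type} (S : Sgpd O A) (C : ChoiceOfReps S.toPreSgpd E)
    {u v : List E} (h : IsPathChain C.esrc C.etgt (u ++ v)) {a b : A}
    (ha : evalPath? S.toPreSgpd C.lab u = some a) (hb : evalPath? S.toPreSgpd C.lab v = some b) :
    S.tgt a = S.src b ∧ evalPath? S.toPreSgpd C.lab (u ++ v) = some (S.mul a b) := by
  have h1 := (eval_ends S C (chain_left h) ha).2
  have h2 := (eval_ends S C (chain_right h) hb).1
  have hc := (List.isChain_append.1 h).2.2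
  rw [pathTgt?, Option.map_eq_some_iff] at h1
  rw [pathSrc?, Option.map_eq_some_iff] at h2
  obtain ⟨x, hx, hx'⟩ := h1
  obtain ⟨y, hy, hy'⟩ := h2
  have h3 : S.tgt a = S.src b := by
    rw [← hx', ← hy']; exact hc x hx y hy
  refine ⟨h3, ?_⟩
  rw [eval_append_fold _ _ ha]
  cases v with
  | nil => simp [evalPath?] at hb
  | cons f v =>
    simp only [evalPath?, Option.some.injEq] at hb
    subst hb
    obtain ⟨h4, -, h5⟩ := fold_props S C v f (C.lab f) (chain_right h) (C.lab_tgt f)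
    rw [h4] at h3
    simp only [List.map_cons, List.foldl_cons]
    rw [h5 a h3]

/-- Right multiplication by an arbitrary arrow. -/
def relZ {O A E : Type} (S : Sgpd O A) (C : ChoiceOfReps S.toPreSgpd E) (z : A) :
    Set (List E × List E) :=
  {p | p.1 ∈ C.K ∧ p.2 ∈ C.K ∧ ∃ a, evalPath? S.toPreSgpd C.lab p.1 = some a ∧
    S.tgt a = S.src z ∧ evalPath? S.toPreSgpd C.lab p.2 = some (S.mul a z)}

theorem SR_relZ_path {O A E : Type} (S : Sgpd O A) (C : ChoiceOfReps S.toPreSgpd E)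
    (hC : IsAutomaticStructure C) (l : List E) (hl : IsPathChain C.esrc C.etgt l) :
    ∀ z, evalPath? S.toPreSgpd C.lab l = some z → SR (relZ S C z) := by
  have edge : ∀ e : E, relZ S C (C.lab e) = relEdge C e := by
    intro e
    ext ⟨u, v⟩
    constructor
    · rintro ⟨hu, hv, a, ha, ht, he⟩
      refine ⟨hu, hv, ?_, ?_⟩
      · rw [(eval_ends S C (C.K_path u hu).2 ha).2, ht, C.lab_src]
      · rw [eval_append_fold _ _ ha]; exact he.symm
    · rintro ⟨hu, hv, ht, he⟩
      obtain ⟨a, ha⟩ := eval_isSome S.toPreSgpd C.lab (C.K_path u hu).1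
      refine ⟨hu, hv, a, ha, ?_, ?_⟩
      · dsimp only at ht
        rw [(eval_ends S C (C.K_path u hu).2 ha).2, Option.some.injEq] at ht
        rw [ht, C.lab_src]
      · rw [eval_append_fold _ _ ha] at he; exact he.symm
  induction l using List.reverseRecOn with
  | nil => intro z hz; simp [evalPath?] at hz
  | append_singleton l e ih =>
    intro z hz
    have he : evalPath? S.toPreSgpd C.lab [e] = some (C.lab e) := rfl
    by_cases hl0 : l = []
    · subst hl0
      rw [List.nil_append, he, Option.some.injEq] at hz
      subst hz
      rw [edge]
      exact SR_of_sync (hC.2.2.1 e)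
    · obtain ⟨y, hy⟩ := eval_isSome S.toPreSgpd C.lab hl0
      have h1 := ih (chain_left hl) y hy
      obtain ⟨h2, h3⟩ := eval_append S C hl hy he
      rw [h3, Option.some.injEq] at hz
      subst hz
      have h4 := SR_comp h1 (SR_of_sync (hC.2.2.1 e))
      rw [← edge] at h4
      convert h4 using 1
      ext ⟨u, v⟩
      constructor
      · rintro ⟨hu, hv, a, ha, ht, hav⟩
        rw [S.src_mul _ _ h2] at ht
        obtain ⟨w, hw, hwe⟩ := C.K_onto (S.mul a y)
        refine ⟨w, ⟨hu, hw, a, ha, ht, hwe⟩, hw, hv, _, hwe, ?_, ?_⟩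
        · rw [S.tgt_mul _ _ ht, h2]
        · rw [S.mul_assoc' _ _ _ ht h2]; exact hav
      · rintro ⟨w, ⟨hu, hw, a, ha, ht, hwe⟩, -, hv, b, hb, hb', hbv⟩
        dsimp only at *
        rw [hwe, Option.some.injEq] at hb
        subst hb
        refine ⟨hu, hv, a, ha, ?_, ?_⟩
        · rw [S.src_mul _ _ h2]; exact ht
        · rw [← S.mul_assoc' _ _ _ ht h2]; exact hbv

theorem SR_relZ {O A E : Type} (S : Sgpd O A) (C : ChoiceOfReps S.toPreSgpd E)
    (hC : IsAutomaticStructure C) (z : A) : SR (relZ S C z) := by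
  obtain ⟨l, hl, hz⟩ := C.K_onto z
  exact SR_relZ_path S C hC l (C.K_path l hl).2 z hz

/-- Length-minimal representatives. -/
def Kmin {O A E : Type} {S : PreSgpd O A} (C : ChoiceOfReps S E) : Set (List E) :=
  {u | u ∈ C.K ∧ ∀ v ∈ C.K, evalPath? S C.lab u = evalPath? S C.lab v → u.length ≤ v.length}

theorem reg_Kmin {O A E : Type} {S : PreSgpd O A} (C : ChoiceOfReps S E)
    (hC : IsAutomaticStructure C) : IsRegularSet (Kmin C) := by
  have := hC.1
  have := reg_inter hC.2.1 (reg_compl (reg_iUnion (ι := E) fun e =>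
    reg_longer (SR_of_sync (hC.2.2.2 (C.etgt e)))))
  convert this using 2
  ext u
  constructor
  · rintro ⟨hu, h⟩
    refine ⟨hu, ?_⟩
    rintro ⟨e, v, ⟨-, hv, -, he⟩, hlt⟩
    exact absurd (h v hv he) (by omega)
  · rintro ⟨hu, h⟩
    refine ⟨hu, fun v hv he => ?_⟩
    by_contra hlt
    have hne := (C.K_path u hu).1
    refine h ⟨u.getLast hne, v, ⟨hu, hv, ?_, he⟩, by omega⟩
    dsimp only
    rw [pathTgt?, List.getLast?_eq_some_getLast hne]; rfl

theorem Kmin_onto {O A E : Type} {S : PreSgpd O A} (C : ChoiceOfReps S E) (a : A) :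
    ∃ u ∈ Kmin C, evalPath? S C.lab u = some a := by
  classical
  have hex : ∃ n, ∃ u ∈ C.K, evalPath? S C.lab u = some a ∧ u.length = n := by
    obtain ⟨u, hu, hu'⟩ := C.K_onto a
    exact ⟨_, u, hu, hu', rfl⟩
  obtain ⟨u, hu, hu', hn⟩ := Nat.find_spec hex
  refine ⟨u, ⟨hu, fun v hv he => ?_⟩, hu'⟩
  rw [hn]
  exact Nat.find_min' hex ⟨v, hv, by rw [← he, hu'], rfl⟩

/-- Long infixes of length-minimal representatives lie in any cofinite ideal. -/
theorem bad_bounded {O A E : Type} (S : Sgpd O A) (C : ChoiceOfReps S.toPreSgpd E)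
    (hC : IsAutomaticStructure C) (T : Set A) (hT : Tᶜ.Finite)
    (hid : ∀ a ∈ T, ∀ b, S.tgt a = S.src b → S.mul a b ∈ T) :
    ∃ m, 0 < m ∧ ∀ u b v, u ++ b ++ v ∈ Kmin C → b.length = m →
      ∃ a ∈ T, evalPath? S.toPreSgpd C.lab b = some a := by
  obtain ⟨σ, hσ, Lf, st, q0, hc, hK⟩ := reg_elim hC.2.1
  have := hT.to_subtype
  refine ⟨Nat.card (σ × (Tᶜ : Set A)) + 1, Nat.succ_pos _, ?_⟩
  intro u b v hw hb
  have hb0 : b ≠ [] := by rintro rfl; simp at hb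
  obtain ⟨a, ha⟩ := eval_isSome S.toPreSgpd C.lab hb0
  refine ⟨a, ?_, ha⟩
  by_contra haT
  have hchain := (C.K_path _ hw.1).2
  have hchb := chain_right (chain_left hchain)
  have hpre : ∀ j : Fin (Nat.card (σ × (Tᶜ : Set A)) + 1),
      ∃ x : (Tᶜ : Set A), evalPath? S.toPreSgpd C.lab (b.take (j + 1)) = some x.1 := by
    intro j
    have hne : b.take (j + 1) ≠ [] := by
      simp [hb0]
    obtain ⟨x, hx⟩ := eval_isSome S.toPreSgpd C.lab hne
    refine ⟨⟨x, fun hxT => haT ?_⟩, hx⟩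
    by_cases hd : b.drop (j + 1) = []
    · have e := List.take_append_drop (j + 1 : ℕ) b
      rw [hd, List.append_nil] at e
      rw [e, ha, Option.some.injEq] at hx
      rwa [hx]
    · obtain ⟨y, hy⟩ := eval_isSome S.toPreSgpd C.lab hd
      have e := List.take_append_drop (j + 1 : ℕ) b
      obtain ⟨h1, h2⟩ := eval_append S C (by rw [e]; exact hchb) hx hy
      rw [e, ha, Option.some.injEq] at h2
      rw [h2]
      exact hid x hxT y h1
  choose X hX using hpre
  have hninj : ¬ Function.Injective
      (fun j => ((u ++ b.take (j.1 + 1)).foldl st q0, X j) :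
        Fin (Nat.card (σ × (Tᶜ : Set A)) + 1) → σ × (Tᶜ : Set A)) := by
    intro hinj
    have := Nat.card_le_card_of_injective _ hinj
    simp at this
  have : ∃ j k : Fin (Nat.card (σ × (Tᶜ : Set A)) + 1), j < k ∧
      (u ++ b.take (j.1 + 1)).foldl st q0 = (u ++ b.take (k.1 + 1)).foldl st q0 ∧ X j = X k := by
    simp only [Function.Injective, not_forall] at hninj
    obtain ⟨j, k, h, hjk⟩ := hninj
    simp only [Prod.mk.injEq] at h
    rcases lt_or_gt_of_ne hjk with hlt | hlt
    · exact ⟨j, k, hlt, h⟩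
    · exact ⟨k, j, hlt, h.1.symm, h.2.symm⟩
  obtain ⟨j, k, hjk, hst, hXX⟩ := this
  have hdec : u ++ b ++ v = (u ++ b.take (k.1 + 1)) ++ (b.drop (k.1 + 1) ++ v) := by
    have e := List.take_append_drop (k.1 + 1) b
    conv_lhs => rw [← e]
    simp only [List.append_assoc]
  have hmem : (u ++ b.take (j.1 + 1)) ++ (b.drop (k.1 + 1) ++ v) ∈ C.K := by
    rw [hK, coalg_append hc, hst, ← coalg_append hc, ← hK, ← hdec]
    exact hw.1
  have hev : evalPath? S.toPreSgpd C.lab (u ++ b.take (j.1 + 1))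
      = evalPath? S.toPreSgpd C.lab (u ++ b.take (k.1 + 1)) := by
    by_cases hu : u = []
    · subst hu
      rw [List.nil_append, List.nil_append, hX, hX, hXX]
    · obtain ⟨y, hy⟩ := eval_isSome S.toPreSgpd C.lab hu
      rw [(eval_append S C (chain_left (C.K_path _ hmem).2) hy (hX j)).2,
        (eval_append S C (chain_left (hdec ▸ hchain)) hy (hX k)).2, hXX]
  have hne : u ++ b.take (k.1 + 1) ≠ [] := by simp [hb0]
  obtain ⟨y, hy⟩ := eval_isSome S.toPreSgpd C.lab hne
  have := hw.2 _ hmem (by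
    rw [hdec, eval_append_fold _ _ hy, eval_append_fold _ _ (hev.trans hy)])
  rw [hdec] at this
  simp only [List.length_append, List.length_take, List.length_drop] at this
  have h1 := j.2
  have h2 := k.2
  have h3 : j.1 < k.1 := hjk
  omega

/-! ### The Rees matrix semigroup -/

theorem fold_eq {O A E : Type} (S : Sgpd O A) (C : ChoiceOfReps S.toPreSgpd E)
    {c : List E} (hc : IsPathChain C.esrc C.etgt c) {a h : A}
    (ha : evalPath? S.toPreSgpd C.lab c = some a) (hh : S.tgt h = S.src a) :
    (c.map C.lab).foldl S.mul h = S.mul h a := by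
  cases c with
  | nil => simp [evalPath?] at ha
  | cons e c =>
    simp only [evalPath?, Option.some.injEq] at ha
    subst ha
    obtain ⟨h4, -, h5⟩ := fold_props S C c e (C.lab e) hc (C.lab_tgt e)
    rw [h4] at hh
    simp only [List.map_cons, List.foldl_cons]
    rw [h5 h hh]

section ReesPart

open Rees

/-- A chosen factorisation `s P_{j i} t` of the value of every word having one. -/
structure Decomp {O A I Λ E : Type} (S : Sgpd O A) (R : Rees.Data S I Λ)
    (C : ChoiceOfReps S.toPreSgpd E) where
  s : List E → A
  j : List E → Λ
  i : List E → I
  t : List E → A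
  spec : ∀ c a, evalPath? S.toPreSgpd C.lab c = some a → a ∈ SPS S R →
    S.tgt (s c) = R.G (j c) ∧ R.F (i c) = S.src (t c) ∧
      a = S.mul (S.mul (s c) (R.P (j c) (i c))) (t c)

theorem exists_decomp {O A I Λ E : Type} [Nonempty A] [Nonempty I] [Nonempty Λ]
    (S : Sgpd O A) (R : Rees.Data S I Λ) (C : ChoiceOfReps S.toPreSgpd E) :
    Nonempty (Decomp S R C) := by
  have : ∀ c : List E, ∃ q : A × Λ × I × A, ∀ a, evalPath? S.toPreSgpd C.lab c = some a →
      a ∈ SPS S R → S.tgt q.1 = R.G q.2.1 ∧ R.F q.2.2.1 = S.src q.2.2.2 ∧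
      a = S.mul (S.mul q.1 (R.P q.2.1 q.2.2.1)) q.2.2.2 := by
    intro c
    by_cases h : ∃ a, evalPath? S.toPreSgpd C.lab c = some a ∧ a ∈ SPS S R
    · obtain ⟨a, ha, s, t, lam, i, h1, h2, h3⟩ := h
      refine ⟨(s, lam, i, t), fun a' ha' _ => ?_⟩
      rw [ha, Option.some.injEq] at ha'
      subst ha'
      rw [R.P_src] at h1
      rw [R.P_tgt] at h2
      exact ⟨h1, h2, h3⟩
    · exact ⟨Classical.arbitrary _, fun a ha ha' => (h ⟨a, ha, ha'⟩).elim⟩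
  choose q hq using this
  exact ⟨⟨fun c => (q c).1, fun c => (q c).2.1, fun c => (q c).2.2.1, fun c => (q c).2.2.2,
    fun c a h h' => hq c a h h'⟩⟩

/-- Letters of the new alphabet. -/
abbrev Letter (I Λ E : Type) (m : ℕ) : Type := I × Option (Chunk E m) × Chunk E m × Λ

/-- The triple denoted by a letter. -/
def rawLab {O A I Λ E : Type} {S : Sgpd O A} {R : Rees.Data S I Λ}
    {C : ChoiceOfReps S.toPreSgpd E} (D : Decomp S R C) (a0 : A) {m : ℕ} (b : Letter I Λ E m) :
    I × A × Λ :=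
  (b.2.1.elim b.1 (fun p => D.i p.1),
    if b.2.2.1.1.length = m then
      b.2.1.elim (D.s b.2.2.1.1) (fun p => S.mul (D.t p.1) (D.s b.2.2.1.1))
    else
      b.2.1.elim ((evalPath? S.toPreSgpd C.lab b.2.2.1.1).getD a0)
        (fun p => (b.2.2.1.1.map C.lab).foldl S.mul (D.t p.1)),
    if b.2.2.1.1.length = m then D.j b.2.2.1.1 else b.2.2.2)

open Classical in
/-- The element denoted by a letter. -/
noncomputable def mLab {O A I Λ E : Type} {S : Sgpd O A} {R : Rees.Data S I Λ}
    {C : ChoiceOfReps S.toPreSgpd E} (D : Decomp S R C) (a0 : A) (m0 : Carrier S R) {m : ℕ}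
    (b : Letter I Λ E m) : Carrier S R :=
  if h : Valid S R.F R.G (rawLab D a0 b) then ⟨rawLab D a0 b, h⟩ else m0

/-- The encoding of `(i, flat x, lam)`. -/
def enc {I Λ E : Type} {m : ℕ} (i : I) (lam : Λ) (x : List (Chunk E m)) : List (Letter I Λ E m) :=
  psi (fun p c => (i, p, c, lam)) none x

theorem mLab_val {O A I Λ E : Type} {S : Sgpd O A} {R : Rees.Data S I Λ}
    {C : ChoiceOfReps S.toPreSgpd E} (D : Decomp S R C) (a0 : A) (m0 : Carrier S R) {m : ℕ}
    (b : Letter I Λ E m) (h : Valid S R.F R.G (rawLab D a0 b)) :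
    (mLab D a0 m0 b).val = rawLab D a0 b := by
  have : mLab D a0 m0 b = ⟨rawLab D a0 b, h⟩ := dif_pos h
  rw [this]

theorem mul_val {O A I Λ : Type} {S : Sgpd O A} {R : Rees.Data S I Λ} (x y : Carrier S R) :
    (Rees.mul S R x y).val =
      (x.val.1, S.mul (S.mul x.val.2.1 (R.P x.val.2.2 y.val.1)) y.val.2.1, y.val.2.2) := rfl

theorem eval_tail {O A I Λ E : Type} {S : Sgpd O A} {R : Rees.Data S I Λ}
    {C : ChoiceOfReps S.toPreSgpd E} (D : Decomp S R C) (a0 : A) (m0 : Carrier S R) {m : ℕ}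
    (hmpos : 0 < m)
    (hm : ∀ u b v, u ++ b ++ v ∈ Kmin C → b.length = m →
      ∃ a ∈ SPS S R, evalPath? S.toPreSgpd C.lab b = some a)
    (i : I) (lam : Λ) (x : List (Chunk E m)) :
    ∀ (b : Chunk E m) (pre : List E) (y g : A) (acc : Carrier S R),
      Chk x → pre ++ flat x ∈ Kmin C → acc.val = (i, y, D.j b.1) →
      R.F (D.i b.1) = S.src (D.t b.1) →
      g = S.mul (S.mul y (R.P (D.j b.1) (D.i b.1))) (D.t b.1) →
      evalPath? S.toPreSgpd C.lab pre = some g →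
      S.tgt (((flat x).map C.lab).foldl S.mul g) = R.G lam →
      (((psi (fun p c => (i, p, c, lam)) (some b) x).map (mLab D a0 m0)).foldl
        (Rees.mul S R) acc).val = (i, ((flat x).map C.lab).foldl S.mul g, lam) := by
  induction x with
  | nil => intro b pre y g acc h; exact h.elim
  | cons c x ih =>
    intro b pre y g acc hchk hK hacc hFb hg hpre htgt
    have hy : S.tgt y = R.G (D.j b.1) := by
      have := acc.2.2
      rw [hacc] at this; exact this
    have hyP : S.tgt y = S.src (R.P (D.j b.1) (D.i b.1)) := by rw [hy, R.P_src]
    have hyPt : S.tgt (S.mul y (R.P (D.j b.1) (D.i b.1))) = S.src (D.t b.1) := by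
      rw [S.tgt_mul _ _ hyP, R.P_tgt, hFb]
    have hgt : S.tgt g = S.tgt (D.t b.1) := by rw [hg, S.tgt_mul _ _ hyPt]
    have hflat : flat (c :: x) = c.1 ++ flat x := by simp [flat]
    rw [hflat, ← List.append_assoc] at hK
    have hchain := (C.K_path _ hK.1).2
    rcases hchk with ⟨hc, hchk⟩ | ⟨hc, rfl⟩
    · obtain ⟨ac, hacT, hac⟩ := hm pre c.1 (flat x) hK hc
      obtain ⟨hs, hF, hdec⟩ := D.spec c.1 ac hac hacT
      obtain ⟨h1, h2⟩ := eval_append S C (chain_left hchain) hpre hac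
      have hsP : S.tgt (D.s c.1) = S.src (R.P (D.j c.1) (D.i c.1)) := by rw [hs, R.P_src]
      have hsPt : S.tgt (S.mul (D.s c.1) (R.P (D.j c.1) (D.i c.1))) = S.src (D.t c.1) := by
        rw [S.tgt_mul _ _ hsP, R.P_tgt, hF]
      have hsrc : S.src ac = S.src (D.s c.1) := by
        rw [hdec, S.src_mul _ _ hsPt, S.src_mul _ _ hsP]
      have hts : S.tgt (D.t b.1) = S.src (D.s c.1) := by rw [← hgt, h1, hsrc]
      have hraw : rawLab D a0 ((i, some b, c, lam) : Letter I Λ E m)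
          = (D.i b.1, S.mul (D.t b.1) (D.s c.1), D.j c.1) := by
        simp [rawLab, hc]
      have hval : Valid S R.F R.G (rawLab D a0 ((i, some b, c, lam) : Letter I Λ E m)) := by
        rw [hraw]
        refine ⟨?_, ?_⟩
        · show R.F (D.i b.1) = S.src (S.mul (D.t b.1) (D.s c.1))
          rw [S.src_mul _ _ hts, hFb]
        · show S.tgt (S.mul (D.t b.1) (D.s c.1)) = R.G (D.j c.1)
          rw [S.tgt_mul _ _ hts, hs]
      have hlab := mLab_val D a0 m0 _ hval
      rw [hraw] at hlab
      have hfold : (c.1.map C.lab).foldl S.mul g = S.mul g ac :=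
        fold_eq S C (chain_right (chain_left hchain)) hac h1
      have hff : ((flat (c :: x)).map C.lab).foldl S.mul g
          = ((flat x).map C.lab).foldl S.mul (S.mul g ac) := by
        rw [hflat, List.map_append, List.foldl_append, hfold]
      rw [hff] at htgt ⊢
      have := ih c (pre ++ c.1)
        (S.mul (S.mul y (R.P (D.j b.1) (D.i b.1))) (S.mul (D.t b.1) (D.s c.1)))
        (S.mul g ac) (Rees.mul S R acc (mLab D a0 m0 (i, some b, c, lam))) hchk hK
        (by rw [mul_val, hlab, hacc]) hF
        (by
          have hgs : S.tgt g = S.src (D.s c.1) := by rw [hgt, hts]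
          have hgsP : S.tgt (S.mul g (D.s c.1)) = S.src (R.P (D.j c.1) (D.i c.1)) := by
            rw [S.tgt_mul _ _ hgs, hsP]
          have hgsp : S.tgt g = S.src (S.mul (D.s c.1) (R.P (D.j c.1) (D.i c.1))) := by
            rw [S.src_mul _ _ hsP, hgs]
          rw [← S.mul_assoc' _ _ _ hyPt hts, ← hg, S.mul_assoc' g _ _ hgs hsP,
            S.mul_assoc' g _ _ hgsp hsPt, ← hdec])
        h2 htgt
      exact this
    · have hraw : rawLab D a0 ((i, some b, c, lam) : Letter I Λ E m)
          = (D.i b.1, (c.1.map C.lab).foldl S.mul (D.t b.1), lam) := by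
        simp [rawLab, hc.ne]
      have hflat' : flat [c] = c.1 := by simp [flat]
      rw [hflat'] at htgt ⊢
      have hkey : (c.1.map C.lab).foldl S.mul g
          = S.mul (S.mul y (R.P (D.j b.1) (D.i b.1))) ((c.1.map C.lab).foldl S.mul (D.t b.1)) ∧
          S.src ((c.1.map C.lab).foldl S.mul (D.t b.1)) = S.src (D.t b.1) ∧
          S.tgt ((c.1.map C.lab).foldl S.mul (D.t b.1)) = R.G lam := by
        by_cases hc0 : c.1 = []
        · rw [hc0] at htgt ⊢
          simp only [List.map_nil, List.foldl_nil] at htgt ⊢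
          exact ⟨hg, trivial, by rw [← hgt, htgt]⟩
        · obtain ⟨ac, hac⟩ := eval_isSome S.toPreSgpd C.lab hc0
          obtain ⟨h1, h2⟩ := eval_append S C (chain_left hchain) hpre hac
          have hcc := chain_right (chain_left hchain)
          have h3 : S.tgt (D.t b.1) = S.src ac := by rw [← hgt, h1]
          rw [fold_eq S C hcc hac h1] at htgt ⊢
          rw [fold_eq S C hcc hac h3]
          refine ⟨?_, S.src_mul _ _ h3, ?_⟩
          · rw [hg, S.mul_assoc' _ _ _ hyPt h3]
          · rw [S.tgt_mul _ _ h3, ← htgt, S.tgt_mul _ _ h1]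
      have hval : Valid S R.F R.G (rawLab D a0 ((i, some b, c, lam) : Letter I Λ E m)) := by
        rw [hraw]
        exact ⟨by rw [hkey.2.1]; exact hFb, hkey.2.2⟩
      have hlab := mLab_val D a0 m0 _ hval
      rw [hraw] at hlab
      show (Rees.mul S R acc (mLab D a0 m0 (i, some b, c, lam))).val = _
      rw [mul_val, hlab, hacc, hkey.1]

/-- Minimal representatives of arrows from `F i` to `G lam`. -/
def KI {O A I Λ E : Type} {S : Sgpd O A} (R : Rees.Data S I Λ) (C : ChoiceOfReps S.toPreSgpd E)
    (i : I) (lam : Λ) : Set (List E) :=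
  {u | u ∈ Kmin C ∧ ∃ a, evalPath? S.toPreSgpd C.lab u = some a ∧ R.F i = S.src a ∧
    S.tgt a = R.G lam}

theorem reg_KI {O A I Λ E : Type} {S : Sgpd O A} (R : Rees.Data S I Λ)
    (C : ChoiceOfReps S.toPreSgpd E) (hC : IsAutomaticStructure C) (i : I) (lam : Λ) :
    IsRegularSet (KI R C i lam) := by
  have := reg_inter (reg_Kmin C hC) (reg_inter (reg_head {e | C.esrc e = R.F i})
    (reg_last {e | C.etgt e = R.G lam}))
  convert this using 2
  ext u
  refine and_congr_right fun hu => ?_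
  obtain ⟨a, ha⟩ := eval_isSome S.toPreSgpd C.lab (C.K_path u hu.1).1
  obtain ⟨h1, h2⟩ := eval_ends S C (C.K_path u hu.1).2 ha
  rw [pathSrc?, Option.map_eq_some_iff] at h1
  rw [pathTgt?, Option.map_eq_some_iff] at h2
  obtain ⟨x, hx, hx'⟩ := h1
  obtain ⟨y, hy, hy'⟩ := h2
  constructor
  · rintro ⟨a', ha', h3, h4⟩
    rw [ha, Option.some.injEq] at ha'
    subst ha'
    exact ⟨⟨x, hx, hx'.trans h3.symm⟩, ⟨y, hy, hy'.trans h4⟩⟩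
  · rintro ⟨⟨x2, hx2, hx3⟩, ⟨y2, hy2, hy3⟩⟩
    rw [Option.mem_def, hx, Option.some.injEq] at hx2
    rw [Option.mem_def, hy, Option.some.injEq] at hy2
    subst hx2 hy2
    exact ⟨a, ha, hx3.symm.trans hx', hy'.symm.trans hy3⟩

theorem eval_enc {O A I Λ E : Type} {S : Sgpd O A} {R : Rees.Data S I Λ}
    {C : ChoiceOfReps S.toPreSgpd E} (D : Decomp S R C) (a0 : A) (m0 : Carrier S R) {m : ℕ}
    (hmpos : 0 < m)
    (hm : ∀ u b v, u ++ b ++ v ∈ Kmin C → b.length = m →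
      ∃ a ∈ SPS S R, evalPath? S.toPreSgpd C.lab b = some a)
    (i : I) (lam : Λ) (x : List (Chunk E m)) (hx : Chk x) (hK : flat x ∈ KI R C i lam) :
    ∃ t : Carrier S R, evalPath? (Rees.pre S R) (mLab D a0 m0) (enc i lam x) = some t ∧
      t.val.1 = i ∧ t.val.2.2 = lam ∧
      evalPath? S.toPreSgpd C.lab (flat x) = some t.val.2.1 := by
  obtain ⟨hK, a, ha, hF, hG⟩ := hK
  suffices h : ∃ t : Carrier S R,
      evalPath? (Rees.pre S R) (mLab D a0 m0) (enc i lam x) = some t ∧ t.val = (i, a, lam) by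
    obtain ⟨t, ht, ht'⟩ := h
    exact ⟨t, ht, by rw [ht'], by rw [ht'], by rw [ht', ha]⟩
  cases x with
  | nil => exact hx.elim
  | cons c x =>
    have hflat : flat (c :: x) = c.1 ++ flat x := by simp [flat]
    refine ⟨_, rfl, ?_⟩
    rw [hflat] at hK ha
    have hchain := (C.K_path _ hK.1).2
    rcases hx with ⟨hc, hchk⟩ | ⟨hc, rfl⟩
    · obtain ⟨ac, hacT, hac⟩ := hm [] c.1 (flat x) hK hc
      obtain ⟨hs, hFc, hdec⟩ := D.spec c.1 ac hac hacT
      have hsP : S.tgt (D.s c.1) = S.src (R.P (D.j c.1) (D.i c.1)) := by rw [hs, R.P_src]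
      have hsPt : S.tgt (S.mul (D.s c.1) (R.P (D.j c.1) (D.i c.1))) = S.src (D.t c.1) := by
        rw [S.tgt_mul _ _ hsP, R.P_tgt, hFc]
      have hsrc : S.src ac = S.src (D.s c.1) := by
        rw [hdec, S.src_mul _ _ hsPt, S.src_mul _ _ hsP]
      have hsrc2 : S.src a = S.src ac := by
        have h1 := (eval_ends S C hchain ha).1
        have h2 := (eval_ends S C (chain_left hchain) hac).1
        have hne := eval_ne_nil hac
        rw [pathSrc?, List.head?_append_of_ne_nil _ hne] at h1
        rw [pathSrc?, h1, Option.some.injEq] at h2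
        exact h2
      have hraw : rawLab D a0 ((i, none, c, lam) : Letter I Λ E m)
          = (i, D.s c.1, D.j c.1) := by
        simp [rawLab, hc]
      have hval : Valid S R.F R.G (rawLab D a0 ((i, none, c, lam) : Letter I Λ E m)) := by
        rw [hraw]
        exact ⟨by rw [hF, hsrc2, hsrc], hs⟩
      have hlab := mLab_val D a0 m0 _ hval
      rw [hraw] at hlab
      rw [eval_append_fold _ _ hac, Option.some.injEq] at ha
      have := eval_tail D a0 m0 hmpos hm i lam x c c.1 (D.s c.1) ac _ hchk hK hlab hFc hdec hac
        (by rw [ha]; exact hG)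
      rw [ha] at this
      exact this
    · have hraw : rawLab D a0 ((i, none, c, lam) : Letter I Λ E m) = (i, a, lam) := by
        have : flat ([] : List (Chunk E m)) = [] := rfl
        rw [this, List.append_nil] at ha
        simp [rawLab, hc.ne, ha]
      have hval : Valid S R.F R.G (rawLab D a0 ((i, none, c, lam) : Letter I Λ E m)) := by
        rw [hraw]
        exact ⟨hF, hG⟩
      have hlab := mLab_val D a0 m0 _ hval
      rw [hraw] at hlab
      exact hlab

theorem chain_unit {E : Type} (s t : E → Unit) (l : List E) : IsPathChain s t l := by
  unfold IsPathChain
  induction l with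
  | nil => exact List.isChain_nil
  | cons a l ih =>
    cases l with
    | nil => exact List.isChain_singleton a
    | cons b l => exact List.isChain_cons_cons.2 ⟨rfl, ih⟩

theorem enc_ne_nil {I Λ E : Type} {m : ℕ} (i : I) (lam : Λ) (x : List (Chunk E m)) (hx : x ≠ []) :
    enc i lam x ≠ [] := by
  rw [enc, ← List.length_pos_iff, psi_length, List.length_pos_iff]; exact hx

theorem rees_automatic {O A I Λ E : Type} [Finite I] [Finite Λ] {S : Sgpd O A}
    {R : Rees.Data S I Λ}
    {C : ChoiceOfReps S.toPreSgpd E} (hC : IsAutomaticStructure C)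
    (D : Decomp S R C) (a0 : A) (m0 : Carrier S R) {m : ℕ}
    (hmpos : 0 < m)
    (hm : ∀ u b v, u ++ b ++ v ∈ Kmin C → b.length = m →
      ∃ a ∈ SPS S R, evalPath? S.toPreSgpd C.lab b = some a) :
    IsAutomatic (Rees.pre S R) := by
  have hE := hC.1
  have hCh : Finite (Chunk E m) := List.finite_length_le E m
  have hev := eval_enc D a0 m0 hmpos hm
  let CM : ChoiceOfReps (Rees.pre S R) (Letter I Λ E m) :=
    { esrc := fun _ => ()
      etgt := fun _ => ()
      lab := mLab D a0 m0
      lab_src := fun _ => rfl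
      lab_tgt := fun _ => rfl
      K := {w | ∃ q : I × Λ, ∃ x ∈ {x | Chk x ∧ flat x ∈ KI R C q.1 q.2}, enc q.1 q.2 x = w}
      K_path := by
        rintro _ ⟨q, x, ⟨hx, -⟩, rfl⟩
        exact ⟨enc_ne_nil _ _ _ hx.ne_nil, chain_unit _ _ _⟩
      K_onto := by
        rintro ⟨⟨i, a, lam⟩, hF, hG⟩
        obtain ⟨u, hu, hua⟩ := Kmin_onto C a
        obtain ⟨x, hx, rfl⟩ := exists_Chk hmpos u
        have hKI : flat x ∈ KI R C i lam := ⟨hu, a, hua, hF, hG⟩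
        obtain ⟨t, ht, h1, h2, h3⟩ := hev i lam x hx hKI
        refine ⟨_, ⟨(i, lam), x, ⟨hx, hKI⟩, rfl⟩, ht.trans ?_⟩
        rw [hua, Option.some.injEq] at h3
        congr 1
        exact Subtype.ext (Prod.ext h1 (Prod.ext h3.symm h2)) }
  refine ⟨_, CM, inferInstance, ?_, ?_, ?_⟩
  · refine reg_iUnion fun q => ?_
    exact reg_mealy (reg_inter (reg_Chk E m) (reg_flatMap (reg_KI R C hC q.1 q.2) Subtype.val)) _ _ _
  · intro g
    rcases hg : (mLab D a0 m0 g).val with ⟨i', y0, lam'⟩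
    have hgv : R.F i' = S.src y0 ∧ S.tgt y0 = R.G lam' := by
      have := (mLab D a0 m0 g).2
      rw [hg] at this; exact this
    have key := reg_iUnion (ι := I × Λ) fun q => sync_psi
      (SR_chunk (m := m) (SR_restrict (SR_relZ S C hC (S.mul (R.P q.2 i') y0))
        (reg_KI R C hC q.1 q.2) (reg_KI R C hC q.1 lam')))
      (fun p hp => ⟨hp.1.ne_nil, hp.2.1.ne_nil⟩)
      (fun p c => ((q.1, p, c, q.2) : Letter I Λ E m))
      (fun p c => ((q.1, p, c, lam') : Letter I Λ E m)) (fun _ => ())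
    unfold SyncRegular
    convert key using 2
    ext w
    have hmulz : ∀ (lam : Λ) (a : A), S.tgt a = R.G lam →
        S.tgt a = S.src (S.mul (R.P lam i') y0) ∧
        S.mul (S.mul a (R.P lam i')) y0 = S.mul a (S.mul (R.P lam i') y0) := by
      intro lam a h
      have h1 : S.tgt a = S.src (R.P lam i') := by rw [h, R.P_src]
      have h2 : S.tgt (R.P lam i') = S.src y0 := by rw [R.P_tgt, hgv.1]
      exact ⟨by rw [S.src_mul _ _ h2, h1], S.mul_assoc' _ _ _ h1 h2⟩
    constructor
    · rintro ⟨⟨_, _⟩, ⟨⟨⟨i, lam⟩, x, ⟨hx, hxK⟩, rfl⟩, ⟨⟨j, mu⟩, y, ⟨hy, hyK⟩, rfl⟩, -, he⟩, rfl⟩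
      obtain ⟨t, ht, h1, h2, h3⟩ := hev i lam x hx hxK
      obtain ⟨t', ht', h1', h2', h3'⟩ := hev j mu y hy hyK
      rw [eval_append_fold _ _ ht, show evalPath? (Rees.pre S R) CM.lab (enc j mu y) = some t'
        from ht', Option.some.injEq] at he
      have hv : (Rees.mul S R t (mLab D a0 m0 g)).val = t'.val := congrArg Subtype.val he
      rw [mul_val, hg] at hv
      rw [← hv] at h1' h2' h3'
      dsimp only at h1' h2' h3' hxK hyK
      rw [h1] at h1'
      subst h1' h2'
      have htt : S.tgt t.val.2.1 = R.G lam := by rw [← h2]; exact t.2.2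
      obtain ⟨h4, h5⟩ := hmulz lam _ htt
      refine ⟨(i, lam), (x, y), ⟨hx, hy, ⟨hxK.1.1, hyK.1.1, _, h3, h4, ?_⟩, hxK, hyK⟩, rfl⟩
      rw [h3', h2, h5]
    · rintro ⟨⟨i, lam⟩, ⟨x, y⟩, ⟨hx, hy, ⟨-, -, a, ha, -, hav⟩, hxK, hyK⟩, rfl⟩
      refine ⟨(enc i lam x, enc i lam' y), ⟨⟨(i, lam), x, ⟨hx, hxK⟩, rfl⟩,
        ⟨(i, lam'), y, ⟨hy, hyK⟩, rfl⟩, ?_, ?_⟩, rfl⟩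
      · obtain ⟨t, ht, -⟩ := hev i lam x hx hxK
        have hne := eval_ne_nil ht
        simp [pathTgt?, List.getLast?_eq_some_getLast hne]
      · obtain ⟨t, ht, h1, h2, h3⟩ := hev i lam x hx hxK
        obtain ⟨t', ht', h1', h2', h3'⟩ := hev i lam' y hy hyK
        have htt : S.tgt t.val.2.1 = R.G lam := by rw [← h2]; exact t.2.2
        obtain ⟨h4, h5⟩ := hmulz lam _ htt
        dsimp only at ha hav h3 h3'
        rw [h3, Option.some.injEq] at ha
        subst ha
        rw [h3', Option.some.injEq] at hav
        rw [eval_append_fold _ _ ht, show evalPath? (Rees.pre S R) CM.lab (enc i lam' y) = some t'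
          from ht', Option.some.injEq]
        show Rees.mul S R t (mLab D a0 m0 g) = t'
        apply Subtype.ext
        rw [mul_val, hg]
        refine Prod.ext (h1.trans h1'.symm) (Prod.ext ?_ h2'.symm)
        show S.mul (S.mul t.val.2.1 (R.P t.val.2.2 i')) y0 = _
        rw [h2, h5, hav]
  · intro v
    have key := reg_iUnion (ι := I × Λ) fun q => sync_psi
      (SR_chunk (m := m) (SR_restrict (SR_of_sync (hC.2.2.2 (R.G q.2)))
        (reg_KI R C hC q.1 q.2) (reg_KI R C hC q.1 q.2)))
      (fun p hp => ⟨hp.1.ne_nil, hp.2.1.ne_nil⟩)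
      (fun p c => ((q.1, p, c, q.2) : Letter I Λ E m))
      (fun p c => ((q.1, p, c, q.2) : Letter I Λ E m)) (fun _ => ())
    unfold SyncRegular
    convert key using 2
    ext w
    constructor
    · rintro ⟨⟨_, _⟩, ⟨⟨⟨i, lam⟩, x, ⟨hx, hxK⟩, rfl⟩, ⟨⟨j, mu⟩, y, ⟨hy, hyK⟩, rfl⟩, -, he⟩, rfl⟩
      obtain ⟨t, ht, h1, h2, h3⟩ := hev i lam x hx hxK
      obtain ⟨t', ht', h1', h2', h3'⟩ := hev j mu y hy hyK
      rw [show evalPath? (Rees.pre S R) CM.lab (enc i lam x) = some t from ht,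
        show evalPath? (Rees.pre S R) CM.lab (enc j mu y) = some t'
        from ht', Option.some.injEq] at he
      subst he
      dsimp only at hxK hyK
      have e1 : i = j := h1.symm.trans h1'
      have e2 : lam = mu := h2.symm.trans h2'
      subst e1 e2
      refine ⟨(i, lam), (x, y), ⟨hx, hy, ⟨hxK.1.1, hyK.1.1, ?_, ?_⟩, hxK, hyK⟩, rfl⟩
      · dsimp only
        rw [(eval_ends S C (C.K_path _ hxK.1.1).2 h3).2, ← h2]
        congr 1; exact t.2.2
      · dsimp only; rw [h3, h3']
    · rintro ⟨⟨i, lam⟩, ⟨x, y⟩, ⟨hx, hy, ⟨-, -, -, he⟩, hxK, hyK⟩, rfl⟩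
      refine ⟨(enc i lam x, enc i lam y), ⟨⟨(i, lam), x, ⟨hx, hxK⟩, rfl⟩,
        ⟨(i, lam), y, ⟨hy, hyK⟩, rfl⟩, ?_, ?_⟩, rfl⟩
      · obtain ⟨t, ht, -⟩ := hev i lam x hx hxK
        have hne := eval_ne_nil ht
        simp [pathTgt?, List.getLast?_eq_some_getLast hne]
      · obtain ⟨t, ht, h1, h2, h3⟩ := hev i lam x hx hxK
        obtain ⟨t', ht', h1', h2', h3'⟩ := hev i lam y hy hyK
        dsimp only at he h3 h3'
        rw [h3, h3', Option.some.injEq] at he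
        show evalPath? (Rees.pre S R) (mLab D a0 m0) (enc i lam x)
          = evalPath? (Rees.pre S R) (mLab D a0 m0) (enc i lam y)
        rw [ht, ht', Option.some.injEq]
        exact Subtype.ext (Prod.ext (h1.trans h1'.symm) (Prod.ext he (h2.trans h2'.symm)))

theorem fold_mul_val {O A I Λ : Type} {S : Sgpd O A} {R : Rees.Data S I Λ}
    (l : List (Carrier S R)) (t : Carrier S R) :
    (l.foldl (Rees.mul S R) t).val.1 = t.val.1 ∧
      (l.foldl (Rees.mul S R) t).val.2.2 = ((t :: l).getLast (by simp)).val.2.2 ∧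
      (l ≠ [] → (l.foldl (Rees.mul S R) t).val.2.1 ∈ SPS S R) := by
  induction l using List.reverseRecOn with
  | nil => simp
  | append_singleton l e ih =>
    rw [List.foldl_append]
    simp only [List.foldl_cons, List.foldl_nil]
    rw [mul_val]
    refine ⟨ih.1, by simp, fun _ => ?_⟩
    refine ⟨_, _, _, _, ?_, ?_, rfl⟩
    · rw [R.P_src]; exact (l.foldl (Rees.mul S R) t).2.2
    · rw [R.P_tgt]; exact e.2.1

end ReesPart

/-- Theorem 6.1: a finitely generated Rees matrix semigroup without zero over an
automatic semigroupoid is automatic. -/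
theorem stmt_15 {O A I Λ : Type} (S : Sgpd O A) (hne : Nonempty A)
    (hiso : IsolationFree S.toPreSgpd)
    (R : Rees.Data S I Λ)
    (hS : IsAutomatic S.toPreSgpd)
    (hfg : IsFG (Rees.pre S R)) :
    IsAutomatic (Rees.pre S R) := by
  obtain ⟨E, C, hC⟩ := hS
  obtain ⟨T, hT, hgen⟩ := hfg
  have hgen' : ∀ a : Rees.Carrier S R, ∃ t ∈ T, ∃ t' ∈ T, a.val.1 = t.val.1 ∧
      a.val.2.2 = t'.val.2.2 ∧ (a.val.2.1 ∉ Rees.SPS S R → a = t) := by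
    intro a
    obtain ⟨l, hl, hlT, -, hev⟩ := hgen a
    cases l with
    | nil => exact (hl rfl).elim
    | cons t l =>
      simp only [evalPath?, List.map_id, id, Option.some.injEq] at hev
      obtain ⟨h1, h2, h3⟩ := fold_mul_val (S := S) (R := R) l t
      have hev' : l.foldl (Rees.mul S R) t = a := hev
      rw [hev'] at h1 h2 h3
      refine ⟨t, hlT t (by simp), _, hlT _ (List.getLast_mem (by simp)), h1, h2, fun hn => ?_⟩
      by_cases hl0 : l = []
      · subst hl0
        exact hev'.symm
      · exact (hn (h3 hl0)).elim
  have hI : Finite I := by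
    refine Set.finite_univ_iff.1 ((hT.image fun t => t.val.1).subset fun i _ => ?_)
    obtain ⟨a, ha⟩ := R.F_into i
    obtain ⟨lam, hlam⟩ := R.G_onto a
    obtain ⟨t, ht, -, -, h, -⟩ := hgen' ⟨(i, a, lam), ha.symm, hlam.symm⟩
    exact ⟨t, ht, h.symm⟩
  have hL : Finite Λ := by
    refine Set.finite_univ_iff.1 ((hT.image fun t => t.val.2.2).subset fun lam _ => ?_)
    obtain ⟨a, ha⟩ := R.G_into lam
    obtain ⟨i, hi⟩ := R.F_onto a
    obtain ⟨-, -, t, ht, -, h, -⟩ := hgen' ⟨(i, a, lam), hi, ha⟩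
    exact ⟨t, ht, h.symm⟩
  have hfin : (Rees.SPS S R)ᶜ.Finite := by
    refine (hT.image fun t => t.val.2.1).subset fun a ha => ?_
    obtain ⟨i, hi⟩ := R.F_onto a
    obtain ⟨lam, hlam⟩ := R.G_onto a
    obtain ⟨t, ht, -, -, -, -, h⟩ := hgen' ⟨(i, a, lam), hi, hlam.symm⟩
    refine ⟨t, ht, ?_⟩
    show t.val.2.1 = a
    rw [← h ha]
  have hideal : ∀ a ∈ Rees.SPS S R, ∀ b, S.tgt a = S.src b → S.mul a b ∈ Rees.SPS S R := by
    rintro _ ⟨s, t, lam, i, h1, h2, rfl⟩ b hb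
    have h3 : S.tgt (S.mul s (R.P lam i)) = S.src t := by rw [S.tgt_mul _ _ h1, h2]
    have h4 : S.tgt t = S.src b := by rw [← hb, S.tgt_mul _ _ h3]
    exact ⟨s, S.mul t b, lam, i, h1, by rw [S.src_mul _ _ h4, h2],
      S.mul_assoc' _ _ _ h3 h4⟩
  obtain ⟨a0⟩ := id hne
  obtain ⟨i0, hi0⟩ := R.F_onto a0
  obtain ⟨lam0, hlam0⟩ := R.G_onto a0
  have : Nonempty I := ⟨i0⟩
  have : Nonempty Λ := ⟨lam0⟩
  obtain ⟨m, hmpos, hm⟩ := bad_bounded S C hC (Rees.SPS S R) hfin hideal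
  obtain ⟨D⟩ := exists_decomp S R C
  exact rees_automatic hC D a0 ⟨(i0, a0, lam0), hi0, hlam0.symm⟩ hmpos hm

end AutoRees
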